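/- arXiv:2407.10350 — 5 statements merged into one kernel-verified Lean document; each statement's English description precedes it below -/
import Mathlib

section
/- Let 1/2 ≤ q < 1, 0 < a ≤ 1/(2q), c > 0 and 0 < p < 2q. Set t_k = (ak+1)^q for k ≥ 0 and ε_k = c/k^p for k ≥ 1, let 0 < s < 1/L, and let (x_k), (y_k) be generated by (TIREPROG) with these parameters. Then (x_k) converges strongly to x*, the minimum norm element of argmin(f+g), and ‖x_k − y_k‖/√ε_k → 0 as k → +∞ (so (y_k) also converges strongly to x*). -/
open Filter Topology
open scoped RealInnerProductSpace

section Auxiliary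

variable {H : Type*} [NormedAddCommGroup H] [InnerProductSpace ℝ H]

theorem hasDerivAt_comp_line [CompleteSpace H] {g : H → ℝ} {g' : H → H}
    (hg : ∀ u : H, HasGradientAt g (g' u) u) (u d : H) (τ : ℝ) :
    HasDerivAt (fun τ : ℝ => g (u + τ • d)) ⟪g' (u + τ • d), d⟫ τ := by
  have h1 : HasDerivAt (fun τ : ℝ => u + τ • d) d τ := by
    simpa using ((hasDerivAt_id τ).smul_const d).const_add u
  have h2 := (hg (u + τ • d)).hasFDerivAt.comp_hasDerivAt τ h1
  rwa [InnerProductSpace.toDual_apply_apply] at h2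

theorem le_linear_add_sq_of_lipschitz_gradient [CompleteSpace H] {g : H → ℝ} {g' : H → H} {L : ℝ}
    (hg : ∀ u : H, HasGradientAt g (g' u) u) (hL : ∀ u v : H, ‖g' u - g' v‖ ≤ L * ‖u - v‖)
    (u v : H) : g v ≤ g u + ⟪g' u, v - u⟫ + L / 2 * ‖v - u‖ ^ 2 := by
  set d := v - u with hd
  let h : ℝ → ℝ := fun τ => g (u + τ • d) - (τ * ⟪g' u, d⟫ + τ ^ 2 * (L / 2 * ‖d‖ ^ 2))
  have hder : ∀ τ : ℝ, HasDerivAt h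
      (⟪g' (u + τ • d), d⟫ - (⟪g' u, d⟫ + 2 * τ * (L / 2 * ‖d‖ ^ 2))) τ := fun τ => by
    have h2 := ((hasDerivAt_id τ).mul_const ⟪g' u, d⟫).add
      (((hasDerivAt_id τ).pow 2).mul_const (L / 2 * ‖d‖ ^ 2))
    have h3 := (hasDerivAt_comp_line hg u d τ).sub h2
    simp only [id, one_mul, mul_one, Nat.cast_ofNat, Nat.add_one_sub_one, pow_one] at h3
    exact h3
  have hanti : AntitoneOn h (Set.Icc 0 1) := by
    apply antitoneOn_of_deriv_nonpos (convex_Icc 0 1)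
    · exact fun τ _ => (hder τ).continuousAt.continuousWithinAt
    · exact fun τ _ => (hder τ).differentiableAt.differentiableWithinAt
    · intro τ hτ
      rw [interior_Icc] at hτ
      rw [(hder τ).deriv]
      have h4 : ⟪g' (u + τ • d) - g' u, d⟫ ≤ L * ‖τ • d‖ * ‖d‖ := by
        refine (real_inner_le_norm _ _).trans ?_
        gcongr
        simpa using hL (u + τ • d) u
      rw [inner_sub_left, norm_smul, Real.norm_of_nonneg hτ.1.le] at h4
      nlinarith
  have h5 := hanti (Set.left_mem_Icc.2 zero_le_one) (Set.right_mem_Icc.2 zero_le_one) zero_le_one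
  simp only [h, zero_smul, one_smul, add_zero, hd, add_sub_cancel] at h5
  simp only [hd]
  linarith

theorem ConvexOn.linear_le_of_hasGradientAt [CompleteSpace H] {g : H → ℝ} {g' : H → H}
    (hc : ConvexOn ℝ Set.univ g) (hg : ∀ u : H, HasGradientAt g (g' u) u) (u v : H) :
    g u + ⟪g' u, v - u⟫ ≤ g v := by
  have hc' : ConvexOn ℝ Set.univ (fun τ : ℝ => g (u + τ • (v - u))) := by
    refine ⟨convex_univ, fun a _ b _ m n hm hn hmn => ?_⟩
    have := hc.2 (Set.mem_univ (u + a • (v - u))) (Set.mem_univ (u + b • (v - u))) hm hn hmn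
    convert this using 2
    simp only [smul_eq_mul]
    have : u = m • u + n • u := by rw [← add_smul, hmn, one_smul]
    nth_rewrite 1 [this]
    module
  have h1 := hasDerivAt_comp_line hg u (v - u) 0
  have h2 := hc'.le_slope_of_hasDerivAt (Set.mem_univ 0) (Set.mem_univ 1) zero_lt_one h1
  simp [slope_def_field] at h2
  linarith

theorem convexOn_toReal {f : H → EReal} (hbot : ∀ z, f z ≠ ⊥)
    (hconv : ∀ u v : H, ∀ a b : ℝ, 0 ≤ a → 0 ≤ b → a + b = 1 →
      f (a • u + b • v) ≤ (a : EReal) * f u + (b : EReal) * f v) :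
    ConvexOn ℝ {z | f z ≠ ⊤} (fun z => (f z).toReal) := by
  have key : ∀ u v : H, f u ≠ ⊤ → f v ≠ ⊤ → ∀ a b : ℝ, 0 ≤ a → 0 ≤ b → a + b = 1 →
      f (a • u + b • v) ≤ ((a * (f u).toReal + b * (f v).toReal : ℝ) : EReal) := by
    intro u v hu hv a b ha hb hab
    have h := hconv u v a b ha hb hab
    rw [← EReal.coe_toReal hu (hbot u), ← EReal.coe_toReal hv (hbot v)] at h
    exact_mod_cast h
  refine ⟨fun u hu v hv a b ha hb hab => ne_top_of_le_ne_top (EReal.coe_ne_top _)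
    (key u v hu hv a b ha hb hab), fun u hu v hv a b ha hb hab => ?_⟩
  have h := key u v hu hv a b ha hb hab
  exact EReal.toReal_le_toReal h (hbot _) (EReal.coe_ne_top _)

theorem toReal_add_le_of_prox {f : H → EReal} (hbot : ∀ z, f z ≠ ⊥)
    (hconv : ConvexOn ℝ {z | f z ≠ ⊤} (fun z => (f z).toReal)) {σ : ℝ} {z p : H}
    (hmin : ∀ u, f p + ((‖p - z‖ ^ 2 / (2 * σ) : ℝ) : EReal)
      ≤ f u + ((‖u - z‖ ^ 2 / (2 * σ) : ℝ) : EReal))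
    {u : H} (hp : f p ≠ ⊤) (hu : f u ≠ ⊤) :
    (f p).toReal + ‖p - z‖ ^ 2 / (2 * σ) + ‖u - p‖ ^ 2 / (2 * σ)
      ≤ (f u).toReal + ‖u - z‖ ^ 2 / (2 * σ) := by
  have hmin' : ∀ v, f v ≠ ⊤ →
      (f p).toReal + ‖p - z‖ ^ 2 / (2 * σ) ≤ (f v).toReal + ‖v - z‖ ^ 2 / (2 * σ) := by
    intro v hv
    have h := hmin v
    rw [← EReal.coe_toReal hp (hbot p), ← EReal.coe_toReal hv (hbot v)] at h
    exact_mod_cast h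
  have hlam : ∀ l : ℝ, l ∈ Set.Ioo (0 : ℝ) 1 →
      (f p).toReal + ‖p - z‖ ^ 2 / (2 * σ) + (1 - l) * (‖u - p‖ ^ 2 / (2 * σ))
      ≤ (f u).toReal + ‖u - z‖ ^ 2 / (2 * σ) := by
    intro l hl
    have hl1 : (0 : ℝ) ≤ 1 - l := by linarith [hl.2]
    have h1 := hmin' _ (hconv.1 hp hu hl1 hl.1.le (by ring))
    have h2 := hconv.2 hp hu hl1 hl.1.le (by ring)
    have h3 : ‖(1 - l) • p + l • u - z‖ ^ 2
        = (1 - l) * ‖p - z‖ ^ 2 + l * ‖u - z‖ ^ 2 - l * (1 - l) * ‖u - p‖ ^ 2 := by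
      have e1 : (1 - l) • p + l • u - z = (1 - l) • (p - z) + l • (u - z) := by module
      have e2 : u - p = (u - z) - (p - z) := by abel
      rw [e1, e2, norm_add_sq_real, norm_sub_sq_real (u - z), norm_smul, norm_smul,
        real_inner_smul_left, real_inner_smul_right, real_inner_comm (p - z), mul_pow, mul_pow]
      simp only [Real.norm_eq_abs, sq_abs]
      ring
    simp only [smul_eq_mul] at h2
    rw [h3, sub_div, add_div, mul_div_assoc, mul_div_assoc, mul_div_assoc] at h1
    have h4 : l * ((f p).toReal + ‖p - z‖ ^ 2 / (2 * σ) + (1 - l) * (‖u - p‖ ^ 2 / (2 * σ)))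
      ≤ l * ((f u).toReal + ‖u - z‖ ^ 2 / (2 * σ)) := by nlinarith
    exact le_of_mul_le_mul_left h4 hl.1
  have hlim : Tendsto (fun l : ℝ => (f p).toReal + ‖p - z‖ ^ 2 / (2 * σ)
      + (1 - l) * (‖u - p‖ ^ 2 / (2 * σ))) (𝓝[>] 0)
      (𝓝 ((f p).toReal + ‖p - z‖ ^ 2 / (2 * σ) + (1 - 0) * (‖u - p‖ ^ 2 / (2 * σ)))) := by
    apply Tendsto.mono_left _ nhdsWithin_le_nhds
    exact Continuous.tendsto (by fun_prop) 0
  rw [sub_zero, one_mul] at hlim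
  refine le_of_tendsto hlim ?_
  filter_upwards [Ioo_mem_nhdsGT zero_lt_one] with l hl using hlam l hl

theorem forward_backward_le [CompleteSpace H] {f : H → EReal} (hbot : ∀ z, f z ≠ ⊥)
    (hconv : ConvexOn ℝ {z | f z ≠ ⊤} (fun z => (f z).toReal))
    {g : H → ℝ} {g' : H → H} {L : ℝ} (hgc : ConvexOn ℝ Set.univ g)
    (hg : ∀ u : H, HasGradientAt g (g' u) u) (hL : ∀ u v : H, ‖g' u - g' v‖ ≤ L * ‖u - v‖)
    {s ε : ℝ} (hs : 0 < s) (hε : 0 ≤ ε) (hsL : s * (L + ε) ≤ 1) {y p : H}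
    (hmin : ∀ u, f p + ((‖p - (y - s • g' y - (s * ε) • y)‖ ^ 2 / (2 * s) : ℝ) : EReal)
      ≤ f u + ((‖u - (y - s • g' y - (s * ε) • y)‖ ^ 2 / (2 * s) : ℝ) : EReal))
    {z : H} (hp : f p ≠ ⊤) (hz : f z ≠ ⊤) :
    (f p).toReal + g p + ε / 2 * ‖p‖ ^ 2 + ‖z - p‖ ^ 2 / (2 * s)
      ≤ (f z).toReal + g z + ε / 2 * ‖z‖ ^ 2 + ‖z - y‖ ^ 2 / (2 * s) := by
  have h1 := toReal_add_le_of_prox hbot hconv hmin hp hz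
  have h2 := le_linear_add_sq_of_lipschitz_gradient hg hL y p
  have h3 := hgc.linear_le_of_hasGradientAt hg y z
  have expand : ∀ v : H, ‖v - (y - s • g' y - (s * ε) • y)‖ ^ 2 / (2 * s)
      = ‖v - y‖ ^ 2 / (2 * s) + ⟪g' y, v - y⟫ + ε * ⟪y, v - y⟫
        + ‖s • g' y + (s * ε) • y‖ ^ 2 / (2 * s) := by
    intro v
    have e : v - (y - s • g' y - (s * ε) • y) = (v - y) + (s • g' y + (s * ε) • y) := by abel
    rw [e, norm_add_sq_real, inner_add_right, real_inner_smul_right, real_inner_smul_right,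
      real_inner_comm (g' y), real_inner_comm y]
    field_simp
    ring
  rw [expand, expand] at h1
  have sq : ∀ v : H, ‖v‖ ^ 2 = ‖y‖ ^ 2 + 2 * ⟪y, v - y⟫ + ‖v - y‖ ^ 2 := by
    intro v
    conv_lhs => rw [← add_sub_cancel y v, norm_add_sq_real]
  have h4 : (L + ε) / 2 * ‖p - y‖ ^ 2 ≤ ‖p - y‖ ^ 2 / (2 * s) := by
    rw [le_div_iff₀ (by positivity)]
    nlinarith [sq_nonneg ‖p - y‖]
  have h5 : 0 ≤ ε / 2 * ‖z - y‖ ^ 2 := by positivity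
  rw [sq p, sq z]
  linarith

theorem norm_sq_combo_le {b : ℝ} (h0 : 0 ≤ b) (h1 : b ≤ 1) (u w : H) :
    ‖b • u - w‖ ^ 2 ≤ b * ‖u - w‖ ^ 2 + (1 - b) * ‖w‖ ^ 2 := by
  have e : ‖b • u - w‖ ^ 2 = b * ‖u - w‖ ^ 2 + (1 - b) * ‖w‖ ^ 2 - b * (1 - b) * ‖u‖ ^ 2 := by
    rw [norm_sub_sq_real, norm_sub_sq_real, norm_smul, real_inner_smul_left, mul_pow,
      Real.norm_eq_abs, sq_abs]
    ring
  have : 0 ≤ b * (1 - b) * ‖u‖ ^ 2 := mul_nonneg (mul_nonneg h0 (by linarith)) (sq_nonneg _)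
  linarith

theorem accelerated_forward_backward_le [CompleteSpace H] {f : H → EReal} (hbot : ∀ z, f z ≠ ⊥)
    (hconv : ConvexOn ℝ {z | f z ≠ ⊤} (fun z => (f z).toReal))
    {g : H → ℝ} {g' : H → H} {L : ℝ} (hgc : ConvexOn ℝ Set.univ g)
    (hg : ∀ u : H, HasGradientAt g (g' u) u) (hL : ∀ u v : H, ‖g' u - g' v‖ ≤ L * ‖u - v‖)
    {s ε t : ℝ} (hs : 0 < s) (hε : 0 ≤ ε) (hsL : s * (L + ε) ≤ 1) (ht : 1 ≤ t) {x y p w : H}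
    (hmin : ∀ u, f p + ((‖p - (y - s • g' y - (s * ε) • y)‖ ^ 2 / (2 * s) : ℝ) : EReal)
      ≤ f u + ((‖u - (y - s • g' y - (s * ε) • y)‖ ^ 2 / (2 * s) : ℝ) : EReal))
    (hp : f p ≠ ⊤) (hx : f x ≠ ⊤) (hw : f w ≠ ⊤) :
    t ^ 2 * (((f p).toReal + g p + ε / 2 * ‖p‖ ^ 2) - ((f w).toReal + g w + ε / 2 * ‖w‖ ^ 2))
        + ‖t • p - (t - 1) • x - w‖ ^ 2 / (2 * s)
      ≤ (t ^ 2 - t) *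
        (((f x).toReal + g x + ε / 2 * ‖x‖ ^ 2) - ((f w).toReal + g w + ε / 2 * ‖w‖ ^ 2))
        + ‖t • y - (t - 1) • x - w‖ ^ 2 / (2 * s) := by
  have ht0 : 0 < t := by linarith
  have hi : 0 ≤ 1 / t := by positivity
  have hi1 : 0 ≤ 1 - 1 / t := by
    rw [sub_nonneg, div_le_one ht0]; exact ht
  set z := (1 - 1 / t) • x + (1 / t) • w with hz
  have hzt : f z ≠ ⊤ := hconv.1 hx hw hi1 hi (by ring)
  have h1 := forward_backward_le hbot hconv hgc hg hL hs hε hsL hmin hp hzt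
  have h2 := hconv.2 hx hw hi1 hi (by ring)
  have h3 := hgc.2 (Set.mem_univ x) (Set.mem_univ w) hi1 hi (by ring)
  have h4 : ‖z‖ ^ 2 ≤ (1 - 1 / t) * ‖x‖ ^ 2 + (1 / t) * ‖w‖ ^ 2 := by
    have := (convexOn_norm (convex_univ (𝕜 := ℝ) (E := H))).pow (fun _ _ => norm_nonneg _) 2
    exact this.2 (Set.mem_univ x) (Set.mem_univ w) hi1 hi (by ring)
  simp only [smul_eq_mul, ← hz] at h2 h3
  have scale : ∀ v : H, ‖t • v - (t - 1) • x - w‖ ^ 2 / (2 * s) =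
      t ^ 2 * (‖z - v‖ ^ 2 / (2 * s)) := by
    intro v
    have e : t • v - (t - 1) • x - w = t • (v - z) := by
      rw [hz, smul_sub, smul_add, smul_smul, smul_smul, mul_sub, mul_one_div_cancel ht0.ne']
      module
    rw [e, norm_smul, mul_pow, norm_sub_rev, Real.norm_eq_abs, sq_abs]
    ring
  rw [scale, scale]
  have h5 : (f p).toReal + g p + ε / 2 * ‖p‖ ^ 2 + ‖z - p‖ ^ 2 / (2 * s) ≤
      (1 - 1 / t) * ((f x).toReal + g x + ε / 2 * ‖x‖ ^ 2)
      + 1 / t * ((f w).toReal + g w + ε / 2 * ‖w‖ ^ 2) + ‖z - y‖ ^ 2 / (2 * s) := by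
    have := mul_le_mul_of_nonneg_left h4 (by positivity : 0 ≤ ε / 2)
    linarith
  have h6 := mul_le_mul_of_nonneg_left h5 (sq_nonneg t)
  have e7 : t ^ 2 * (1 / t) = t := by field_simp
  have e8 : ∀ A : ℝ, t ^ 2 * (1 / t * A) = t * A := fun A => by rw [← mul_assoc, e7]
  have e9 : ∀ A : ℝ, t ^ 2 * ((1 - 1 / t) * A) = (t ^ 2 - t) * A := fun A => by
    rw [← mul_assoc, mul_sub, e7, mul_one]
  rw [mul_add, mul_add _ (_ + 1 / t * _), mul_add _ ((1 - 1 / t) * _), e8, e9] at h6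
  linarith

theorem tendsto_of_eventually_mem_antitone_convex [CompleteSpace H] {C : ℕ → Set H}
    (hanti : Antitone C) (hclosed : ∀ n, IsClosed (C n)) (hconv : ∀ n, Convex ℝ (C n))
    {w : H} (hw : ∀ n, w ∈ C n) (hmin : ∀ u, (∀ n, u ∈ C n) → ‖w‖ ≤ ‖u‖)
    {x : ℕ → H} (hx : ∀ n, ∀ᶠ k in atTop, x k ∈ C n)
    (hnorm : ∀ δ > 0, ∀ᶠ k in atTop, ‖x k‖ ^ 2 ≤ ‖w‖ ^ 2 + δ) :
    Tendsto x atTop (𝓝 w) := by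
  have hproj : ∀ n, ∃ v ∈ C n, ∀ z ∈ C n, ‖z - v‖ ^ 2 ≤ ‖z‖ ^ 2 - ‖v‖ ^ 2 := by
    intro n
    obtain ⟨v, hv, hv'⟩ := exists_norm_eq_iInf_of_complete_convex ⟨w, hw n⟩
      (hclosed n).isComplete (hconv n) 0
    refine ⟨v, hv, fun z hz => ?_⟩
    have h := (norm_eq_iInf_iff_real_inner_le_zero (hconv n) hv).1 hv' z hz
    have e : ‖z‖ ^ 2 = ‖v‖ ^ 2 + 2 * ⟪v, z - v⟫ + ‖z - v‖ ^ 2 := by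
      conv_lhs => rw [← add_sub_cancel v z, norm_add_sq_real]
    rw [zero_sub, inner_neg_left] at h
    linarith
  choose v hv hvz using hproj
  have hmono : Monotone fun n => ‖v n‖ ^ 2 := fun m n hmn => by
    have := hvz m (v n) (hanti hmn (hv n))
    have h2 := sq_nonneg ‖v n - v m‖
    simp only; linarith
  have hbdd : BddAbove (Set.range fun n => ‖v n‖ ^ 2) := by
    refine ⟨‖w‖ ^ 2, ?_⟩
    rintro _ ⟨n, rfl⟩
    have := hvz n w (hw n)
    have h2 := sq_nonneg ‖w - v n‖
    simp only; linarith
  have hlim := tendsto_atTop_ciSup hmono hbdd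
  set l := ⨆ n, ‖v n‖ ^ 2
  have hle : ∀ n, ‖v n‖ ^ 2 ≤ l := fun n => le_ciSup hbdd n
  have hcauchy : CauchySeq v := by
    refine cauchySeq_of_le_tendsto_0 (fun n => 2 * √(l - ‖v n‖ ^ 2)) (fun m n N hm hn => ?_) ?_
    · have key : ∀ k, N ≤ k → dist (v k) (v N) ≤ √(l - ‖v N‖ ^ 2) := fun k hk => by
        rw [dist_eq_norm]
        apply Real.le_sqrt_of_sq_le
        linarith [hvz N (v k) (hanti hk (hv k)), hle k]
      linarith [dist_triangle_right (v m) (v n) (v N), key m hm, key n hn]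
    · have : Tendsto (fun n => 2 * √(l - ‖v n‖ ^ 2)) atTop (𝓝 (2 * √(l - l))) :=
        ((tendsto_const_nhds.sub hlim).sqrt).const_mul 2
      simpa using this
  obtain ⟨z, hz⟩ := cauchySeq_tendsto_of_complete hcauchy
  have hzC : ∀ n, z ∈ C n := fun n => (hclosed n).mem_of_tendsto hz
    (eventually_atTop.2 ⟨n, fun m hm => hanti hm (hv m)⟩)
  have hlz : l = ‖z‖ ^ 2 := tendsto_nhds_unique hlim (hz.norm.pow 2)
  have hwl : ‖w‖ ^ 2 ≤ l := hlz ▸ pow_le_pow_left₀ (norm_nonneg _) (hmin z hzC) 2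
  rw [Metric.tendsto_atTop']
  intro r hr
  have hδ : 0 < (r / 2) ^ 2 / 2 := by positivity
  obtain ⟨n, hn⟩ := (hlim.eventually (lt_mem_nhds (sub_lt_self l hδ))).exists
  obtain ⟨N, hN⟩ := eventually_atTop.1 ((hx n).and (hnorm _ hδ))
  refine ⟨N, fun k hk => ?_⟩
  obtain ⟨h1, h2⟩ := hN k hk.le
  have h3 := hvz n _ h1
  have h4 := hvz n w (hw n)
  have hlw : ‖w‖ ^ 2 - ‖v n‖ ^ 2 < (r / 2) ^ 2 / 2 := by linarith
  have h5 : ‖x k - v n‖ < r / 2 := lt_of_pow_lt_pow_left₀ 2 (by positivity) (by linarith)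
  have h6 : ‖w - v n‖ < r / 2 := lt_of_pow_lt_pow_left₀ 2 (by positivity) (by linarith)
  rw [← dist_eq_norm] at h5 h6
  linarith [dist_triangle_right (x k) w (v n)]

theorem eventually_le_of_contraction {r θ η : ℕ → ℝ} (hθ : ∀ᶠ k in atTop, 0 ≤ θ k ∧ θ k ≤ 1)
    (hsum : ¬ Summable θ) (hη : Tendsto η atTop (𝓝 0))
    (hr : ∀ᶠ k in atTop, r (k + 1) ≤ (1 - θ k) * max (r k) 0 + θ k * η k) :
    ∀ δ > 0, ∀ᶠ k in atTop, r k ≤ δ := by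
  intro δ hδ
  obtain ⟨N, hN⟩ := eventually_atTop.1
    ((hθ.and hr).and (hη.eventually (gt_mem_nhds (half_pos hδ))))
  have hθN : ∀ n, 0 ≤ θ (n + N) := fun n => (hN (n + N) (by omega)).1.1.1
  set A := max (r N) 0 with hA
  have hA0 : 0 ≤ A := le_max_right _ _
  have hbound : ∀ n, r (n + N) ≤ δ / 2 + A * Real.exp (-∑ i ∈ Finset.range n, θ (i + N)) := by
    intro n
    induction n with
    | zero =>
      simp only [zero_add, Finset.range_zero, Finset.sum_empty, neg_zero, Real.exp_zero, mul_one]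
      linarith [le_max_left (r N) 0]
    | succ n ih =>
      obtain ⟨⟨⟨h0, h1⟩, h2⟩, h3⟩ := hN (n + N) (by omega)
      rw [Finset.sum_range_succ, neg_add, Real.exp_add]
      set E := Real.exp (-∑ i ∈ Finset.range n, θ (i + N))
      have hE : 0 ≤ A * E := mul_nonneg hA0 (Real.exp_pos _).le
      have h4 : max (r (n + N)) 0 ≤ δ / 2 + A * E := max_le ih (by linarith)
      have h5 : 1 - θ (n + N) ≤ Real.exp (-θ (n + N)) := by
        linarith [Real.add_one_le_exp (-θ (n + N))]
      have h6 := mul_le_mul_of_nonneg_left h4 (sub_nonneg.2 h1)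
      have h7 := mul_le_mul_of_nonneg_left h5 hE
      have h8 := mul_le_mul_of_nonneg_left h3.le h0
      rw [show n + 1 + N = n + N + 1 by ring]
      linarith
  have hdiv : Tendsto (fun n => ∑ i ∈ Finset.range n, θ (i + N)) atTop atTop :=
    (not_summable_iff_tendsto_nat_atTop_of_nonneg hθN).1
      (fun h => hsum ((summable_nat_add_iff N).1 h))
  have hexp : Tendsto (fun n => A * Real.exp (-∑ i ∈ Finset.range n, θ (i + N))) atTop (𝓝 0) := by
    simpa using (Real.tendsto_exp_neg_atTop_nhds_zero.comp hdiv).const_mul A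
  obtain ⟨K, hK⟩ := eventually_atTop.1 (hexp.eventually (gt_mem_nhds (half_pos hδ)))
  refine eventually_atTop.2 ⟨K + N, fun k hk => ?_⟩
  have h1 := hbound (k - N)
  have h2 := hK (k - N) (by omega)
  rw [show k - N + N = k by omega] at h1
  linarith

theorem isClosed_le_sub {X : Type*} [TopologicalSpace X] {f : X → EReal}
    (hf : LowerSemicontinuous f) {g : X → ℝ} (hg : Continuous g) (m : ℝ) :
    IsClosed {z | f z ≤ ((m - g z : ℝ) : EReal)} := by
  have h : Continuous fun z => (z, ((m - g z : ℝ) : EReal)) :=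
    continuous_id.prodMk (continuous_coe_real_ereal.comp (continuous_const.sub hg))
  exact hf.isClosed_epigraph.preimage h

section Parameters

variable {q a c p : ℝ}

theorem one_le_rpow_step (ha : 0 < a) (hq : 0 ≤ q) (k : ℕ) : 1 ≤ (a * k + 1) ^ q :=
  Real.one_le_rpow (le_add_of_nonneg_left (by positivity)) hq

theorem rpow_step_sq_sub_le (hq1 : 1 / 2 ≤ q) (hq2 : q ≤ 1) (ha : 0 < a) (ha2 : a ≤ 1 / (2 * q))
    {k : ℕ} (hk : 1 ≤ k) :
    ((a * k + 1) ^ q) ^ 2 - (a * k + 1) ^ q ≤ ((a * ((k - 1 : ℕ) : ℝ) + 1) ^ q) ^ 2 := by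
  have hk' : (1 : ℝ) ≤ k := by exact_mod_cast hk
  have hak : a ≤ a * k := le_mul_of_one_le_right ha.le hk'
  set b := a * k + 1 with hb
  have hb1 : 1 ≤ b := by linarith
  have hb0 : 0 < b := by linarith
  have e : a * ((k - 1 : ℕ) : ℝ) + 1 = b * (1 + -(a / b)) := by
    rw [Nat.cast_sub hk]; field_simp; rw [hb]; push_cast; ring
  have hab : a / b ≤ 1 := (div_le_one hb0).2 (by linarith)
  have h1 := one_add_mul_self_le_rpow_one_add (s := -(a / b)) (by linarith) (p := 2 * q)
    (by linarith)
  have h2q : ∀ z : ℝ, 0 ≤ z → (z ^ q) ^ 2 = z ^ (2 * q) := fun z hz => by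
    rw [← Real.rpow_natCast, ← Real.rpow_mul hz, mul_comm]; norm_num
  rw [e, h2q b hb0.le, h2q _ (mul_nonneg hb0.le (by linarith)), Real.mul_rpow hb0.le (by linarith)]
  have h3 := mul_le_mul_of_nonneg_left h1 (Real.rpow_pos_of_pos hb0 (2 * q)).le
  have h4 : b ^ (2 * q) * (2 * q * (a / b)) ≤ b ^ q := by
    have h5 : 2 * q * a ≤ 1 := by rwa [le_div_iff₀ (by linarith), mul_comm] at ha2
    have h6 : b ^ (2 * q) ≤ b ^ q * b := by
      rw [← Real.rpow_add_one hb0.ne']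
      exact Real.rpow_le_rpow_of_exponent_le hb1 (by linarith)
    rw [← mul_div_assoc, ← mul_div_assoc, div_le_iff₀ hb0]
    nlinarith [Real.rpow_pos_of_pos hb0 (2 * q)]
  linarith

theorem tendsto_rpow_step_div (hq1 : 0 ≤ q) (hq2 : q < 1) (ha : 0 < a) :
    Tendsto (fun k : ℕ => (a * k + 1) ^ q / k) atTop (𝓝 0) := by
  have hlim : Tendsto (fun k : ℕ => (a + 1) ^ q * (k : ℝ) ^ (-(1 - q))) atTop (𝓝 0) := by
    simpa using ((tendsto_rpow_neg_atTop (sub_pos.2 hq2)).comp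
      tendsto_natCast_atTop_atTop).const_mul ((a + 1) ^ q)
  refine squeeze_zero' (Eventually.of_forall fun k => by positivity) ?_ hlim
  filter_upwards [eventually_ge_atTop 1] with k hk
  have hk' : (1 : ℝ) ≤ k := by exact_mod_cast hk
  have hk0 : (0 : ℝ) < k := by linarith
  have h1 : (a * k + 1) ^ q ≤ ((a + 1) * k) ^ q :=
    Real.rpow_le_rpow (by positivity) (by linarith) hq1
  rw [Real.mul_rpow (by positivity) hk0.le] at h1
  rw [div_le_iff₀ hk0, mul_assoc, ← Real.rpow_add_one hk0.ne']
  simpa using h1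

theorem div_rpow_ratio_sub_one_le (hc : 0 < c) (hp0 : 0 ≤ p) (hp2 : p ≤ 2) {k : ℕ} (hk : 1 ≤ k) :
    0 ≤ (c / (k : ℝ) ^ p) / (c / ((k + 1 : ℕ) : ℝ) ^ p) - 1 ∧
    (c / (k : ℝ) ^ p) / (c / ((k + 1 : ℕ) : ℝ) ^ p) - 1 ≤ 3 / k := by
  have hk' : (1 : ℝ) ≤ k := by exact_mod_cast hk
  have hk0 : (0 : ℝ) < k := by linarith
  have e : (c / (k : ℝ) ^ p) / (c / ((k + 1 : ℕ) : ℝ) ^ p) = (1 + 1 / (k : ℝ)) ^ p := by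
    have h1 : 1 + 1 / (k : ℝ) = ((k + 1 : ℕ) : ℝ) / k := by push_cast; field_simp
    rw [h1, Real.div_rpow (by positivity) hk0.le]
    have := Real.rpow_pos_of_pos hk0 p
    have : 0 < ((k + 1 : ℕ) : ℝ) ^ p := by positivity
    field_simp
  have h1 : 1 ≤ 1 + 1 / (k : ℝ) := by simp
  rw [e]
  refine ⟨sub_nonneg.2 (Real.one_le_rpow h1 hp0), ?_⟩
  have h2 := Real.rpow_le_rpow_of_exponent_le h1 hp2
  rw [Real.rpow_two] at h2
  have h3 : 1 / (k : ℝ) ≤ 1 := (div_le_one hk0).2 hk'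
  have h4 : (3 : ℝ) / k = 3 * (1 / k) := by ring
  have h5 : 0 ≤ 1 / (k : ℝ) := by positivity
  nlinarith

theorem tendsto_rpow_step_sq_mul (hq0 : 0 < q) (ha : 0 < a) (ha1 : a ≤ 1) (hc : 0 < c)
    (hp2 : p < 2 * q) :
    Tendsto (fun k : ℕ => ((a * ((k - 1 : ℕ) : ℝ) + 1) ^ q) ^ 2 * (c / (k : ℝ) ^ p))
      atTop atTop := by
  have hlim : Tendsto (fun k : ℕ => (a ^ q) ^ 2 * c * (k : ℝ) ^ (2 * q - p)) atTop atTop :=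
    ((tendsto_rpow_atTop (sub_pos.2 hp2)).comp tendsto_natCast_atTop_atTop).const_mul_atTop
      (by positivity)
  refine tendsto_atTop_mono' _ ?_ hlim
  filter_upwards [eventually_ge_atTop 1] with k hk
  have hk' : (1 : ℝ) ≤ k := by exact_mod_cast hk
  have hk0 : (0 : ℝ) < k := by linarith
  have h1 : (a * k) ^ q ≤ (a * ((k - 1 : ℕ) : ℝ) + 1) ^ q := by
    refine Real.rpow_le_rpow (by positivity) ?_ hq0.le
    rw [Nat.cast_sub hk]; push_cast; linarith
  have h2 := pow_le_pow_left₀ (by positivity) h1 2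
  have h3 : (a ^ q) ^ 2 * c * (k : ℝ) ^ (2 * q - p) = ((a * k) ^ q) ^ 2 * (c / (k : ℝ) ^ p) := by
    rw [Real.mul_rpow ha.le hk0.le, Real.rpow_sub hk0, mul_comm 2 q, Real.rpow_mul hk0.le,
      Real.rpow_two]
    ring
  rw [h3]
  gcongr

theorem not_summable_one_div_rpow_step (hq2 : q ≤ 1) (ha : 0 < a) :
    ¬ Summable fun k : ℕ => 1 / (2 * (a * k + 1) ^ q) := by
  intro h
  have h2 : Summable fun k : ℕ => 1 / ((k + 1 : ℕ) : ℝ) := by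
    refine Summable.of_nonneg_of_le (fun k => by positivity) (fun k => ?_)
      (h.mul_left (2 * (a + 1)))
    have hb : 1 ≤ a * k + 1 := by
      have : 0 ≤ a * k := by positivity
      linarith
    have h3 : (a * k + 1) ^ q ≤ a * k + 1 := by
      simpa using Real.rpow_le_rpow_of_exponent_le hb hq2
    have h4 : (0 : ℝ) < (a * k + 1) ^ q := by positivity
    rw [mul_one_div, div_le_div_iff₀ (by positivity) (by positivity)]
    push_cast
    nlinarith [(Nat.cast_nonneg k : (0 : ℝ) ≤ k)]
  exact Real.not_summable_one_div_natCast ((summable_nat_add_iff 1).1 h2)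

end Parameters

theorem eventually_energy_le {t ε E : ℕ → ℝ} {M₁ M₂ : ℝ} (ht : ∀ k, 1 ≤ t k)
    (hε : ∀ᶠ k in atTop, 0 < ε k)
    (hratio : ∀ᶠ k in atTop, 0 ≤ ε k / ε (k + 1) - 1)
    (hratio_t : Tendsto (fun k => t k * (ε k / ε (k + 1) - 1)) atTop (𝓝 0))
    (hsum : ¬ Summable fun k => 1 / (2 * t k))
    (hb : Tendsto (fun k => t (k - 1) ^ 2 * ε k) atTop atTop)
    (hE : ∀ᶠ k in atTop, E (k + 1) ≤ (t k ^ 2 - t k) / t (k - 1) ^ 2 * E k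
      + (1 - (t k ^ 2 - t k) / t (k - 1) ^ 2) * M₁ + t k ^ 2 * (ε k - ε (k + 1)) * M₂) :
    ∀ δ > 0, ∀ᶠ k in atTop, E k ≤ δ * (t (k - 1) ^ 2 * ε k) := by
  have ht0 : ∀ k, 0 < t k := fun k => zero_lt_one.trans_le (ht k)
  have hr : ∀ δ > 0, ∀ᶠ k in atTop, (E k - M₁) / (t (k - 1) ^ 2 * ε k) ≤ δ := by
    refine eventually_le_of_contraction (θ := fun k => 1 / (2 * t k))
      (η := fun k => 2 * M₂ * (t k * (ε k / ε (k + 1) - 1))) ?_ hsum ?_ ?_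
    · refine Eventually.of_forall fun k => ⟨by have := ht0 k; positivity, ?_⟩
      rw [div_le_one (by linarith [ht0 k])]
      linarith [ht k]
    · simpa using hratio_t.const_mul (2 * M₂)
    · filter_upwards [hε, (tendsto_add_atTop_nat 1).eventually hε, hratio,
        hratio_t.eventually (gt_mem_nhds (by norm_num : (0 : ℝ) < 1 / 2)), hE]
        with k h0 h1 h2 h3 h4
      set ρ := ε k / ε (k + 1) - 1 with hρ
      have htk := ht0 k
      have htk' := ht0 (k - 1)
      have hεk : ε k = (1 + ρ) * ε (k + 1) := by rw [hρ]; field_simp; ring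
      set r := (E k - M₁) / (t (k - 1) ^ 2 * ε k) with hrdef
      have hEk : E k = r * (t (k - 1) ^ 2 * ε k) + M₁ := by rw [hrdef]; field_simp; ring
      have hstep : (E (k + 1) - M₁) / (t (k + 1 - 1) ^ 2 * ε (k + 1))
          ≤ (1 - 1 / t k) * (1 + ρ) * r + ρ * M₂ := by
        rw [Nat.add_sub_cancel, div_le_iff₀ (by positivity)]
        have e : (t k ^ 2 - t k) / t (k - 1) ^ 2 * E k
            + (1 - (t k ^ 2 - t k) / t (k - 1) ^ 2) * M₁ + t k ^ 2 * (ε k - ε (k + 1)) * M₂ - M₁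
            = ((1 - 1 / t k) * (1 + ρ) * r + ρ * M₂) * (t k ^ 2 * ε (k + 1)) := by
          rw [hEk, hεk]; field_simp; ring
        linarith
      have hcoef0 : 0 ≤ (1 - 1 / t k) * (1 + ρ) :=
        mul_nonneg (sub_nonneg.2 ((div_le_one htk).2 (ht k))) (by linarith)
      have hcoef : (1 - 1 / t k) * (1 + ρ) ≤ 1 - 1 / (2 * t k) := by
        have h5 : ρ ≤ 1 / (2 * t k) := by
          rw [le_div_iff₀ (by positivity)]; linarith
        have h6 : 1 / t k = 2 * (1 / (2 * t k)) := by field_simp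
        have h7 : 0 ≤ 1 / t k * ρ := by positivity
        linarith
      have h8 := mul_le_mul_of_nonneg_left (le_max_left r 0) hcoef0
      have h9 := mul_le_mul_of_nonneg_right hcoef (le_max_right r 0)
      have h10 : 1 / (2 * t k) * (2 * M₂ * (t k * ρ)) = ρ * M₂ := by field_simp
      linarith
  intro δ hδ
  filter_upwards [hr (δ / 2) (half_pos hδ), hb.eventually_ge_atTop (M₁ * (2 / δ)),
    hb.eventually_gt_atTop 0] with k h1 h2 h3
  rw [div_le_iff₀ h3] at h1
  have h4 : M₁ ≤ δ / 2 * (t (k - 1) ^ 2 * ε k) := by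
    have := mul_le_mul_of_nonneg_left h2 (half_pos hδ).le
    have e : δ / 2 * (M₁ * (2 / δ)) = M₁ := by field_simp
    linarith
  linarith

/-- The convergence statement for general parameter sequences `t` and `ε`. -/
theorem tireprog_tendsto [CompleteSpace H] {f : H → EReal} {g : H → ℝ} {g' : H → H} {L : ℝ}
    (hbot : ∀ z, f z ≠ ⊥) (hconv : ConvexOn ℝ {z | f z ≠ ⊤} (fun z => (f z).toReal))
    (hlsc : LowerSemicontinuous f) (hgc : ConvexOn ℝ Set.univ g)
    (hg : ∀ u : H, HasGradientAt g (g' u) u) (hL : ∀ u v : H, ‖g' u - g' v‖ ≤ L * ‖u - v‖)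
    {s : ℝ} (hs : 0 < s) (hsL : s * L < 1) {t ε : ℕ → ℝ} (ht : ∀ k, 1 ≤ t k) (htm : Monotone t)
    (htsq : ∀ k, 1 ≤ k → t k ^ 2 - t k ≤ t (k - 1) ^ 2)
    (hε : ∀ k, 1 ≤ k → 0 < ε k) (hε0 : Tendsto ε atTop (𝓝 0))
    (hratio : ∀ᶠ k in atTop, 0 ≤ ε k / ε (k + 1) - 1)
    (hratio_t : Tendsto (fun k => t k * (ε k / ε (k + 1) - 1)) atTop (𝓝 0))
    (hsum : ¬ Summable fun k => 1 / (2 * t k))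
    (hb : Tendsto (fun k => t (k - 1) ^ 2 * ε k) atTop atTop)
    {x y : ℕ → H}
    (hy : ∀ k, 1 ≤ k → t k • y k - (t k - 1) • x k = ((t k ^ 2 - t k) / t (k - 1) ^ 2) •
      (t (k - 1) • x k - (t (k - 1) - 1) • x (k - 1)))
    (hx : ∀ k, 1 ≤ k → ∀ u,
      f (x (k + 1)) +
          ((‖x (k + 1) - (y k - s • g' (y k) - (s * ε k) • y k)‖ ^ 2 / (2 * s) : ℝ) : EReal)
        ≤ f u + ((‖u - (y k - s • g' (y k) - (s * ε k) • y k)‖ ^ 2 / (2 * s) : ℝ) : EReal))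
    {w : H} (hwtop : f w ≠ ⊤)
    (hwmin : ∀ u, f u ≠ ⊤ → (f w).toReal + g w ≤ (f u).toReal + g u)
    (hwnorm : ∀ u, f u ≠ ⊤ → (f u).toReal + g u ≤ (f w).toReal + g w → ‖w‖ ≤ ‖u‖) :
    Tendsto x atTop (𝓝 w) ∧ Tendsto (fun k => ‖x k - y k‖ / √(ε k)) atTop (𝓝 0) := by
  have ht0 : ∀ k, 0 < t k := fun k => zero_lt_one.trans_le (ht k)
  have hxtop : ∀ k, 2 ≤ k → f (x k) ≠ ⊤ := by
    intro k hk htop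
    obtain ⟨k, rfl⟩ : ∃ j, k = j + 1 := ⟨k - 1, by omega⟩
    have h := hx k (by omega) w
    rw [htop, EReal.top_add_coe, ← EReal.coe_toReal hwtop (hbot w), ← EReal.coe_add,
      top_le_iff] at h
    exact EReal.coe_ne_top _ h
  have hεev : ∀ᶠ k in atTop, 0 < ε k := eventually_atTop.2 ⟨1, hε⟩
  let u : ℕ → H := fun k => t (k - 1) • x k - (t (k - 1) - 1) • x (k - 1)
  let D : ℕ → ℝ := fun k => ((f (x k)).toReal + g (x k) + ε k / 2 * ‖x k‖ ^ 2)
    - ((f w).toReal + g w + ε k / 2 * ‖w‖ ^ 2)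
  let E : ℕ → ℝ := fun k => t (k - 1) ^ 2 * D k + ‖u k - w‖ ^ 2 / (2 * s)
  have hβ0 : ∀ k, 0 ≤ (t k ^ 2 - t k) / t (k - 1) ^ 2 := fun k =>
    div_nonneg (by nlinarith [ht k]) (sq_nonneg _)
  have hβ1 : ∀ k, 1 ≤ k → (t k ^ 2 - t k) / t (k - 1) ^ 2 ≤ 1 := fun k hk =>
    (div_le_one (pow_pos (ht0 _) 2)).2 (htsq k hk)
  have hsε : ∀ᶠ k in atTop, s * (L + ε k) ≤ 1 := by
    have h : Tendsto (fun k => s * (L + ε k)) atTop (𝓝 (s * (L + 0))) :=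
      (hε0.const_add L).const_mul s
    rw [add_zero] at h
    filter_upwards [h.eventually (gt_mem_nhds hsL)] with k hk using hk.le
  have hE : ∀ᶠ k in atTop, E (k + 1) ≤ (t k ^ 2 - t k) / t (k - 1) ^ 2 * E k
      + (1 - (t k ^ 2 - t k) / t (k - 1) ^ 2) * (‖w‖ ^ 2 / (2 * s))
      + t k ^ 2 * (ε k - ε (k + 1)) * (‖w‖ ^ 2 / 2) := by
    filter_upwards [hsε, hratio, eventually_ge_atTop 2] with k h1 h2 hk
    have hk1 : 1 ≤ k := by omega
    have hε1 := hε (k + 1) (by omega)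
    have h3 := accelerated_forward_backward_le hbot hconv hgc hg hL hs (hε k hk1).le h1 (ht k)
      (hx k hk1) (hxtop (k + 1) (by omega)) (hxtop k hk) hwtop
    rw [hy k hk1] at h3
    have h4 := div_le_div_of_nonneg_right (norm_sq_combo_le (hβ0 k) (hβ1 k hk1) (u k) w)
      (by positivity : 0 ≤ 2 * s)
    have h5 : ε (k + 1) ≤ ε k := by
      rw [sub_nonneg, le_div_iff₀ hε1] at h2; linarith
    have h6 : 0 ≤ t k ^ 2 * (ε k - ε (k + 1)) * (‖x (k + 1)‖ ^ 2 / 2) :=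
      mul_nonneg (mul_nonneg (sq_nonneg _) (by linarith)) (by positivity)
    have h7 : (t k ^ 2 - t k) / t (k - 1) ^ 2 * (t (k - 1) ^ 2 * D k) = (t k ^ 2 - t k) * D k := by
      have := ht0 (k - 1)
      field_simp
    simp only [E, mul_add, h7]
    rw [add_div, mul_div_assoc, mul_div_assoc] at h4
    simp only [D, u, Nat.add_sub_cancel] at h4 ⊢
    linarith
  have hEle := eventually_energy_le ht hεev hratio hratio_t hsum hb hE
  have hD : ∀ δ > 0, ∀ᶠ k in atTop, D k ≤ δ * ε k := by
    intro δ hδ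
    filter_upwards [hEle δ hδ] with k hk
    have h1 : 0 ≤ ‖u k - w‖ ^ 2 / (2 * s) := by positivity
    have h2 : t (k - 1) ^ 2 * D k ≤ t (k - 1) ^ 2 * (δ * ε k) := by
      simp only [E] at hk; linarith
    exact le_of_mul_le_mul_left h2 (pow_pos (ht0 _) 2)
  have hnorm : ∀ δ > 0, ∀ᶠ k in atTop, ‖x k‖ ^ 2 ≤ ‖w‖ ^ 2 + δ := by
    intro δ hδ
    filter_upwards [hD (δ / 2) (half_pos hδ), hεev, eventually_ge_atTop 2] with k h1 h2 hk
    have h3 := hwmin _ (hxtop k hk)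
    have h4 : ε k * ‖x k‖ ^ 2 ≤ ε k * (‖w‖ ^ 2 + δ) := by
      simp only [D] at h1; linarith
    exact le_of_mul_le_mul_left h4 h2
  have hgcont : Continuous g := continuous_iff_continuousAt.2 fun z => (hg z).continuousAt
  have hmem : ∀ (m : ℝ) (z : H), f z ≤ ((m - g z : ℝ) : EReal) ↔
      f z ≠ ⊤ ∧ (f z).toReal + g z ≤ m := by
    intro m z
    constructor
    · intro h
      have hz : f z ≠ ⊤ := ne_top_of_le_ne_top (EReal.coe_ne_top _) h
      rw [← EReal.coe_toReal hz (hbot z), EReal.coe_le_coe_iff] at h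
      exact ⟨hz, by linarith⟩
    · rintro ⟨hz, h⟩
      rw [← EReal.coe_toReal hz (hbot z), EReal.coe_le_coe_iff]
      linarith
  let C : ℕ → Set H := fun n =>
    {z | f z ≤ (((f w).toReal + g w + 1 / ((n : ℝ) + 1) - g z : ℝ) : EReal)}
  have hC : ∀ n z, z ∈ C n ↔
      f z ≠ ⊤ ∧ (f z).toReal + g z ≤ (f w).toReal + g w + 1 / ((n : ℝ) + 1) :=
    fun n z => hmem _ z
  have hsumconv : ConvexOn ℝ {z | f z ≠ ⊤} (fun z => (f z).toReal + g z) :=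
    hconv.add (hgc.subset (Set.subset_univ _) hconv.1)
  have hxw : Tendsto x atTop (𝓝 w) := by
    refine tendsto_of_eventually_mem_antitone_convex (C := C) ?_
      (fun n => isClosed_le_sub hlsc hgcont _) ?_ ?_ ?_ ?_ hnorm
    · intro m n hmn z hz
      rw [hC] at hz ⊢
      exact ⟨hz.1, hz.2.trans (by gcongr)⟩
    · intro n
      convert hsumconv.convex_le ((f w).toReal + g w + 1 / ((n : ℝ) + 1)) using 1
      ext z
      exact hC n z
    · intro n
      rw [hC]
      exact ⟨hwtop, le_add_of_nonneg_right (by positivity)⟩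
    · intro z hz
      refine hwnorm z ((hC 0 z).1 (hz 0)).1 ?_
      have hlim : Tendsto (fun n : ℕ => (f w).toReal + g w + 1 / ((n : ℝ) + 1)) atTop
          (𝓝 ((f w).toReal + g w + 0)) := tendsto_one_div_add_atTop_nhds_zero_nat.const_add _
      rw [add_zero] at hlim
      exact ge_of_tendsto' hlim fun n => ((hC n z).1 (hz n)).2
    · intro n
      have hlim : Tendsto (fun k => ε k * (1 + ‖w‖ ^ 2 / 2)) atTop (𝓝 0) := by
        simpa using hε0.mul_const (1 + ‖w‖ ^ 2 / 2)
      filter_upwards [hD 1 one_pos, hεev, eventually_ge_atTop 2, hlim.eventually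
        (gt_mem_nhds (by positivity : (0 : ℝ) < 1 / ((n : ℝ) + 1)))] with k h1 h2 hk h3
      rw [hC]
      refine ⟨hxtop k hk, ?_⟩
      have h4 : 0 ≤ ε k / 2 * ‖x k‖ ^ 2 := by positivity
      simp only [D] at h1
      linarith
  refine ⟨hxw, ?_⟩
  have hsqrtb : Tendsto (fun k => √(t (k - 1) ^ 2 * ε k)) atTop atTop :=
    Real.tendsto_sqrt_atTop.comp hb
  have hu : Tendsto (fun k => ‖u k - w‖ / √(t (k - 1) ^ 2 * ε k)) atTop (𝓝 0) := by
    rw [Metric.tendsto_atTop']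
    intro r hr
    have hδ : 0 < r ^ 2 / (8 * s) := by positivity
    have hxn : Tendsto (fun k => ‖x k‖ ^ 2) atTop (𝓝 (‖w‖ ^ 2)) := hxw.norm.pow 2
    obtain ⟨N, hN⟩ := eventually_atTop.1 ((((hEle _ hδ).and (hb.eventually_gt_atTop 0)).and
      (hxn.eventually (lt_mem_nhds (sub_lt_self _ hδ)))).and (hεev.and (eventually_ge_atTop 2)))
    refine ⟨N, fun k hk => ?_⟩
    obtain ⟨⟨⟨h1, h2⟩, h3⟩, h4, hk2⟩ := hN k hk.le
    rw [Real.dist_eq, sub_zero, abs_of_nonneg (by positivity), div_lt_iff₀ (Real.sqrt_pos.2 h2)]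
    refine lt_of_pow_lt_pow_left₀ 2 (by positivity) ?_
    rw [mul_pow, Real.sq_sqrt h2.le]
    have h5 := hwmin _ (hxtop k hk2)
    have h6 : -(r ^ 2 / (8 * s)) * ε k ≤ D k := by
      simp only [D]
      nlinarith
    have h7 := mul_le_mul_of_nonneg_left h6 (sq_nonneg (t (k - 1)))
    have h8 : ‖u k - w‖ ^ 2 / (2 * s) ≤ 2 * (r ^ 2 / (8 * s)) * (t (k - 1) ^ 2 * ε k) := by
      simp only [E] at h1
      linarith
    rw [div_le_iff₀ (by positivity)] at h8
    have h9 : 2 * (r ^ 2 / (8 * s)) * (t (k - 1) ^ 2 * ε k) * (2 * s)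
        = r ^ 2 * (t (k - 1) ^ 2 * ε k) / 2 := by field_simp; ring
    have h10 : 0 < r ^ 2 * (t (k - 1) ^ 2 * ε k) := by positivity
    linarith
  have hbig : Tendsto (fun k => ‖u k - w‖ / √(t (k - 1) ^ 2 * ε k)
      + (‖w‖ + ‖x k‖) / √(t (k - 1) ^ 2 * ε k)) atTop (𝓝 0) := by
    simpa using hu.add ((hxw.norm.const_add ‖w‖).div_atTop hsqrtb)
  refine squeeze_zero' (Eventually.of_forall fun k => by positivity) ?_ hbig
  filter_upwards [hεev, eventually_ge_atTop 1] with k h1 hk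
  have htk := ht0 k
  have hle : ‖t k • (x k - y k)‖ ≤ ‖x k‖ + ‖u k‖ := by
    have e : t k • (x k - y k) = x k - ((t k ^ 2 - t k) / t (k - 1) ^ 2) • u k := by
      rw [← hy k hk]; module
    rw [e]
    refine (norm_sub_le _ _).trans ?_
    rw [norm_smul, Real.norm_of_nonneg (hβ0 k)]
    linarith [mul_le_mul_of_nonneg_right (hβ1 k hk) (norm_nonneg (u k))]
  have hun : ‖u k‖ ≤ ‖u k - w‖ + ‖w‖ := by simpa using norm_add_le (u k - w) w
  rw [norm_smul, Real.norm_of_nonneg htk.le] at hle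
  have htt : t (k - 1) ≤ t k := htm (by omega)
  have hpos : 0 < √(ε k) := Real.sqrt_pos.2 h1
  rw [← add_div, Real.sqrt_mul (sq_nonneg _), Real.sqrt_sq (ht0 _).le, ← div_div]
  refine div_le_div_of_nonneg_right ?_ hpos.le
  rw [le_div_iff₀ (ht0 (k - 1))]
  linarith [mul_le_mul_of_nonneg_right htt (norm_nonneg (x k - y k))]

end Auxiliary

theorem tireprog_p_strong_convergence
    {H : Type*} [NormedAddCommGroup H] [InnerProductSpace ℝ H] [CompleteSpace H]
    (f : H → EReal) (g : H → ℝ) (g' : H → H) (L : ℝ) (hL : 0 < L)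
    -- f is proper, convex and lower semicontinuous
    (hf_proper : ∃ z, f z ≠ ⊤) (hf_nebot : ∀ z, f z ≠ ⊥)
    (hf_convex : ∀ u v : H, ∀ a b : ℝ, 0 ≤ a → 0 ≤ b → a + b = 1 →
      f (a • u + b • v) ≤ (a : EReal) * f u + (b : EReal) * f v)
    (hf_lsc : LowerSemicontinuous f)
    -- g is convex, differentiable with L-Lipschitz gradient g'
    (hg_convex : ConvexOn ℝ Set.univ g)
    (hg_diff : ∀ u : H, HasGradientAt g (g' u) u)
    (hg_lip : ∀ u v : H, ‖g' u - g' v‖ ≤ L * ‖u - v‖)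
    -- prox_{σ f} is a minimizer of u ↦ f(u) + ‖u − z‖²/(2σ)
    (prox : ℝ → H → H)
    (hprox : ∀ σ : ℝ, 0 < σ → ∀ z u : H,
      f (prox σ z) + ((‖prox σ z - z‖ ^ 2 / (2 * σ) : ℝ) : EReal)
        ≤ f u + ((‖u - z‖ ^ 2 / (2 * σ) : ℝ) : EReal))
    -- the parameters q, a, c, p with t_k = (ak+1)^q and ε_k = c/k^p
    (q a c p : ℝ) (hq1 : 1 / 2 ≤ q) (hq2 : q < 1)
    (ha1 : 0 < a) (ha2 : a ≤ 1 / (2 * q)) (hc : 0 < c) (hp1 : 0 < p) (hp2 : p < 2 * q)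
    (t : ℕ → ℝ) (ht : ∀ k : ℕ, t k = (a * k + 1) ^ q)
    (ε : ℕ → ℝ) (hε : ∀ k : ℕ, 1 ≤ k → ε k = c / (k : ℝ) ^ p)
    -- the stepsize
    (s : ℝ) (hs_pos : 0 < s) (hs_lt : s < 1 / L)
    -- the algorithm (TIREPROG)
    (x y : ℕ → H)
    (hy : ∀ k : ℕ, 1 ≤ k → y k = x k
        + (((t k - 1) * (t (k - 1) - 1)) / (t (k - 1)) ^ 2) • (x k - x (k - 1))
        - (((-(t k) ^ 2 + t k + (t (k - 1)) ^ 2) / ((t (k - 1)) ^ 2 * t k))) • x k)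
    (hx : ∀ k : ℕ, 1 ≤ k →
      x (k + 1) = prox s (y k - s • g' (y k) - (s * ε k) • y k))
    -- x* is the minimum norm element of argmin (f + g)
    (xstar : H)
    (hxstar_min : ∀ u : H, f xstar + (g xstar : EReal) ≤ f u + (g u : EReal))
    (hxstar_norm : ∀ u : H,
      (∀ v : H, f u + (g u : EReal) ≤ f v + (g v : EReal)) → ‖xstar‖ ≤ ‖u‖)
 :
    Tendsto x atTop (nhds xstar) ∧
    Tendsto (fun k : ℕ => ‖x k - y k‖ / Real.sqrt (ε k)) atTop (nhds (0 : ℝ)) ∧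
    Tendsto y atTop (nhds xstar) := by
  have hq0 : 0 < q := by linarith
  have ha_le : a ≤ 1 := ha2.trans ((div_le_one (by linarith)).2 (by linarith))
  have ht1 : ∀ k, 1 ≤ t k := fun k => by
    rw [ht k]
    exact one_le_rpow_step ha1 hq0.le k
  have htm : Monotone t := fun m n hmn => by
    rw [ht m, ht n]
    gcongr
  have htsq : ∀ k, 1 ≤ k → t k ^ 2 - t k ≤ t (k - 1) ^ 2 := fun k hk => by
    rw [ht k, ht (k - 1)]
    exact rpow_step_sq_sub_le hq1 hq2.le ha1 ha2 hk
  have hεpos : ∀ k, 1 ≤ k → 0 < ε k := fun k hk => by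
    have : (0 : ℝ) < k := by exact_mod_cast hk
    rw [hε k hk]
    positivity
  have hy' : ∀ k : ℕ, 1 ≤ k → t k • y k - (t k - 1) • x k =
      ((t k ^ 2 - t k) / t (k - 1) ^ 2) •
        (t (k - 1) • x k - (t (k - 1) - 1) • x (k - 1)) := by
    intro k hk
    have h1 := zero_lt_one.trans_le (ht1 k)
    have h2 := zero_lt_one.trans_le (ht1 (k - 1))
    rw [hy k hk]
    match_scalars
    · field_simp
      ring
    · field_simp
  have hbsq : Tendsto (fun k => t (k - 1) ^ 2 * ε k) atTop atTop := by
    refine (tendsto_rpow_step_sq_mul hq0 ha1 ha_le hc hp2).congr' ?_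
    filter_upwards [eventually_ge_atTop 1] with k hk
    rw [ht, hε k hk]
  have hε0 : Tendsto ε atTop (𝓝 0) := by
    have h : Tendsto (fun k : ℕ => c / (k : ℝ) ^ p) atTop (𝓝 0) :=
      tendsto_const_nhds.div_atTop ((tendsto_rpow_atTop hp1).comp tendsto_natCast_atTop_atTop)
    refine h.congr' ?_
    filter_upwards [eventually_ge_atTop 1] with k hk
    rw [hε k hk]
  have hratio : ∀ k : ℕ, 1 ≤ k →
      0 ≤ ε k / ε (k + 1) - 1 ∧ ε k / ε (k + 1) - 1 ≤ 3 / k := by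
    intro k hk
    rw [hε k hk, hε (k + 1) (by omega)]
    exact div_rpow_ratio_sub_one_le hc hp1.le (by linarith) hk
  have hratio_t : Tendsto (fun k => t k * (ε k / ε (k + 1) - 1)) atTop (𝓝 0) := by
    have h : Tendsto (fun k : ℕ => 3 * ((a * k + 1) ^ q / k)) atTop (𝓝 0) := by
      simpa using (tendsto_rpow_step_div hq0.le hq2 ha1).const_mul 3
    refine squeeze_zero' ?_ ?_ h
    · filter_upwards [eventually_ge_atTop 1] with k hk
      exact mul_nonneg (zero_le_one.trans (ht1 k)) (hratio k hk).1
    · filter_upwards [eventually_ge_atTop 1] with k hk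
      have h1 := mul_le_mul_of_nonneg_left (hratio k hk).2 (zero_le_one.trans (ht1 k))
      rw [ht k] at h1 ⊢
      exact h1.trans_eq (by ring)
  have hsum : ¬ Summable fun k => 1 / (2 * t k) := by
    simpa only [ht] using not_summable_one_div_rpow_step hq2.le ha1
  have hwtop : f xstar ≠ ⊤ := by
    obtain ⟨z, hz⟩ := hf_proper
    intro h
    have h1 := hxstar_min z
    rw [h, EReal.top_add_coe, ← EReal.coe_toReal hz (hf_nebot z), ← EReal.coe_add,
      top_le_iff] at h1
    exact EReal.coe_ne_top _ h1
  have hsum_eq : ∀ z, f z ≠ ⊤ →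
      f z + (g z : EReal) = (((f z).toReal + g z : ℝ) : EReal) := fun z hz => by
    rw [EReal.coe_add, EReal.coe_toReal hz (hf_nebot z)]
  have hwmin : ∀ u, f u ≠ ⊤ → (f xstar).toReal + g xstar ≤ (f u).toReal + g u := by
    intro u hu
    have h := hxstar_min u
    rwa [hsum_eq _ hwtop, hsum_eq u hu, EReal.coe_le_coe_iff] at h
  have hwnorm : ∀ u, f u ≠ ⊤ → (f u).toReal + g u ≤ (f xstar).toReal + g xstar →
      ‖xstar‖ ≤ ‖u‖ := by
    intro u hu h
    refine hxstar_norm u fun v => le_trans ?_ (hxstar_min v)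
    rwa [hsum_eq _ hwtop, hsum_eq u hu, EReal.coe_le_coe_iff]
  have hsL : s * L < 1 := (lt_div_iff₀ hL).1 hs_lt
  obtain ⟨hxlim, hxy⟩ := tireprog_tendsto hf_nebot (convexOn_toReal hf_nebot hf_convex) hf_lsc
    hg_convex hg_diff hg_lip hs_pos hsL ht1 htm htsq hεpos hε0
    (eventually_atTop.2 ⟨1, fun k hk => (hratio k hk).1⟩) hratio_t hsum hbsq hy'
    (fun k hk u => by rw [hx k hk]; exact hprox s hs_pos _ u) hwtop hwmin hwnorm
  refine ⟨hxlim, hxy, ?_⟩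
  have hdiff : Tendsto (fun k => ‖x k - y k‖) atTop (𝓝 0) := by
    have h : Tendsto (fun k => ‖x k - y k‖ / √(ε k) * √(ε k)) atTop (𝓝 (0 * √0)) :=
      hxy.mul hε0.sqrt
    rw [zero_mul] at h
    refine h.congr' ?_
    filter_upwards [eventually_ge_atTop 1] with k hk
    exact div_mul_cancel₀ _ (Real.sqrt_pos.2 (hεpos k hk)).ne'
  simpa using hxlim.sub (tendsto_zero_iff_norm_tendsto_zero.2 hdiff)
end

section
/- Let 1/2 ≤ q < 1, 0 < a ≤ 1/(2q), c > 0 and 0 < p < 2q. Set t_k = (ak+1)^q for k ≥ 0 and ε_k = c/k^p for k ≥ 1, let 0 < s < 1/L, and let (x_k), (y_k) be generated by (TIREPROG) with these parameters. Then: k^p (F_k(x_k) − F_k(x̄_k)) → 0 as k → +∞; there exist C > 0 and K ∈ ℕ with (f+g)(x_k) − min(f+g) ≤ C k^{−p} for all k ≥ K; k^{p/2} ‖x_k − x_{k−1}‖ → 0 as k → +∞; and there exists a sequence (u_k) with u_k ∈ ∂f(x_k) + ∇g(x_k) such that k^{p/2} ‖u_k‖ → 0 as k → +∞. -/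
open Filter Topology
open scoped RealInnerProductSpace

theorem tendsto_zero_of_le_one_sub_mul_add {r α β : ℕ → ℝ} (hr : ∀ n, 0 ≤ r n)
    (hα0 : ∀ n, 0 ≤ α n) (hα1 : ∀ n, α n ≤ 1) (hα : ¬ Summable α)
    (hβ : Tendsto β atTop (𝓝 0))
    (h : ∀ᶠ n in atTop, r (n + 1) ≤ (1 - α n) * r n + α n * β n) :
    Tendsto r atTop (𝓝 0) := by
  rw [Metric.tendsto_atTop]
  intro δ hδ
  have hβ' : ∀ᶠ n in atTop, β n < δ / 2 := hβ.eventually_lt_const (by positivity)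
  obtain ⟨N, hN⟩ := eventually_atTop.1 (h.and hβ')
  have hstep : ∀ n, N ≤ n → r n - δ / 2 ≤
      Real.exp (-(∑ i ∈ Finset.range n, α i)) *
        (Real.exp (∑ i ∈ Finset.range N, α i) * r N) := by
    intro n hn
    induction n, hn using Nat.le_induction with
    | base =>
      rw [← mul_assoc, ← Real.exp_add, neg_add_cancel, Real.exp_zero, one_mul]
      linarith
    | succ n hn ih =>
      obtain ⟨h1, h2⟩ := hN n hn
      set Q := Real.exp (∑ i ∈ Finset.range N, α i) * r N with hQ
      have hQ0 : 0 ≤ Q := mul_nonneg (Real.exp_pos _).le (hr N)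
      have hexp : 1 - α n ≤ Real.exp (-α n) := by
        have := Real.add_one_le_exp (-α n)
        linarith
      rw [Finset.sum_range_succ, neg_add, Real.exp_add]
      set e := Real.exp (-∑ i ∈ Finset.range n, α i) with he
      have he0 : 0 < e := Real.exp_pos _
      calc r (n + 1) - δ / 2 ≤ (1 - α n) * (r n - δ / 2) := by
            nlinarith [hα0 n]
        _ ≤ (1 - α n) * (e * Q) := mul_le_mul_of_nonneg_left ih (by linarith [hα1 n])
        _ ≤ Real.exp (-α n) * (e * Q) := mul_le_mul_of_nonneg_right hexp (by positivity)
        _ = e * Real.exp (-α n) * Q := by ring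
  have hdiv := (not_summable_iff_tendsto_nat_atTop_of_nonneg hα0).1 hα
  have hlim : Tendsto (fun n => Real.exp (-(∑ i ∈ Finset.range n, α i)) *
        (Real.exp (∑ i ∈ Finset.range N, α i) * r N)) atTop (𝓝 0) := by
    have := (Real.tendsto_exp_neg_atTop_nhds_zero.comp hdiv).mul_const
      (Real.exp (∑ i ∈ Finset.range N, α i) * r N)
    simpa using this
  obtain ⟨M, hM⟩ := eventually_atTop.1 (hlim.eventually_lt_const (half_pos hδ))
  refine ⟨max N M, fun n hn => ?_⟩
  have h1 := hstep n (le_of_max_le_left hn)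
  have h2 := hM n (le_of_max_le_right hn)
  rw [Real.dist_eq, sub_zero, abs_of_nonneg (hr n)]
  linarith

/-- The normalized energy of an accelerated scheme tends to be nonpositive. -/
theorem tendsto_posPart_energy_ratio {A t ε : ℕ → ℝ} {W s : ℝ} (hW : 0 ≤ W)
    (ht1 : ∀ n, 1 ≤ t n) (htmono : ∀ n, t n ≤ t (n + 1))
    (hε : ∀ n, 1 ≤ n → 0 < ε n) (hεanti : ∀ n, 1 ≤ n → ε (n + 1) ≤ ε n)
    (hη : Tendsto (fun n => t (n + 1) * (ε n / ε (n + 1) - 1)) atTop (𝓝 0))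
    (hinv : Tendsto (fun n => 1 / (t n ^ 2 * ε (n + 1))) atTop (𝓝 0))
    (hsum : ¬ Summable (fun n => 1 / t n)) (hs : 0 < s)
    (hA : ∀ᶠ n in atTop, A (n + 1) ≤ (t (n + 1) ^ 2 - t (n + 1)) / t n ^ 2 * A n
      + (1 - (t (n + 1) ^ 2 - t (n + 1)) / t n ^ 2) * W
      + s * (t (n + 1) ^ 2 - t (n + 1)) * (ε n - ε (n + 1)) * W) :
    Tendsto (fun n => max (A n / (t n ^ 2 * ε n)) 0) atTop (𝓝 0) := by
  have ht0 : ∀ n, 0 < t n := fun n => lt_of_lt_of_le one_pos (ht1 n)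
  have hα : ¬ Summable (fun n => 1 / (2 * t (n + 1))) := by
    intro h
    apply hsum
    rw [← summable_nat_add_iff 1]
    refine (h.mul_left 2).congr fun n => ?_
    have := (ht0 (n + 1)).ne'
    field_simp
  have hβ : Tendsto (fun n => 2 * W * (1 / (t n ^ 2 * ε (n + 1))
      + s * (t (n + 1) * (ε n / ε (n + 1) - 1)))) atTop (𝓝 0) := by
    simpa using (hinv.add (hη.const_mul s)).const_mul (2 * W)
  refine tendsto_zero_of_le_one_sub_mul_add (α := fun n => 1 / (2 * t (n + 1)))
    (fun n => le_max_right _ _) (fun n => ?_) (fun n => ?_) hα hβ ?_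
  · have := ht0 (n + 1); positivity
  · rw [div_le_one (by linarith [ht0 (n + 1)])]; linarith [ht1 (n + 1)]
  filter_upwards [hA, eventually_ge_atTop 1,
    hη.eventually_lt_const (show (0 : ℝ) < 1 / 2 by norm_num)] with n hn h1 hsmall
  have he0 := hε n h1
  have he1 := hε (n + 1) (by omega)
  have hT0 := ht0 n
  have hT1 := ht0 (n + 1)
  have hη0 : 0 ≤ ε n / ε (n + 1) - 1 := by
    rw [sub_nonneg, one_le_div he1]; exact hεanti n h1
  have hεn : ε n = (1 + (ε n / ε (n + 1) - 1)) * ε (n + 1) := by field_simp; ring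
  set η := ε n / ε (n + 1) - 1 with hηdef
  have hT1' := ht1 (n + 1)
  have hmono := htmono n
  clear_value η
  set a := A n / (t n ^ 2 * ε n) with ha
  have hAn : A n = a * (t n ^ 2 * ε n) := by rw [ha]; field_simp
  clear_value a
  rw [hAn, hεn] at hn
  generalize ε (n + 1) = e at *
  generalize t (n + 1) = T at *
  generalize t n = τ at *
  have hb0 : 0 ≤ 1 - 1 / (2 * T) := by
    rw [sub_nonneg, div_le_one (by linarith)]; linarith
  have hq0 : 0 ≤ 1 / (τ ^ 2 * e) := by positivity
  have hfirst : A (n + 1) / (T ^ 2 * e) ≤ (1 - 1 / T) * (1 + η) * a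
      + (1 / T) * W * (1 / (τ ^ 2 * e) + s * (T * η)) := by
    rw [div_le_iff₀ (by positivity)]
    refine hn.trans ?_
    have h2 : (1 - (T ^ 2 - T) / τ ^ 2) * W ≤ T / τ ^ 2 * W := by
      apply mul_le_mul_of_nonneg_right _ hW
      rw [one_sub_div (by positivity)]
      gcongr
      nlinarith
    have h3 : s * (T ^ 2 - T) * ((1 + η) * e - e) * W ≤ s * T ^ 2 * (η * e) * W := by
      have : (1 + η) * e - e = η * e := by ring
      rw [this]
      gcongr
      linarith
    have h4 : ((1 - 1 / T) * (1 + η) * a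
      + (1 / T) * W * (1 / (τ ^ 2 * e) + s * (T * η))) * (T ^ 2 * e) =
      (T ^ 2 - T) / τ ^ 2 * (a * (τ ^ 2 * ((1 + η) * e))) + T / τ ^ 2 * W
        + s * T ^ 2 * (η * e) * W := by
      field_simp
      ring
    rw [h4]
    linarith
  have hcoef : (1 - 1 / T) * (1 + η) ≤ 1 - 1 / (2 * T) := by
    have h5 : η ≤ 1 / (2 * T) := by
      rw [le_div_iff₀ (by positivity)]; linarith
    have h6 : 1 / T = 2 * (1 / (2 * T)) := by field_simp
    have h7 : 0 ≤ 1 / T := by positivity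
    nlinarith
  have hcoef0 : 0 ≤ (1 - 1 / T) * (1 + η) := by
    apply mul_nonneg _ (by linarith)
    rw [sub_nonneg, div_le_one hT1]; exact hT1'
  have hlast : (1 / T) * W * (1 / (τ ^ 2 * e) + s * (T * η)) =
      1 / (2 * T) * (2 * W * (1 / (τ ^ 2 * e) + s * (T * η))) := by
    field_simp
  apply max_le
  · calc _ ≤ _ := hfirst
      _ ≤ (1 - 1 / T) * (1 + η) * max a 0 + (1 / T) * W * (1 / (τ ^ 2 * e) + s * (T * η)) := by
          gcongr; exact le_max_left _ _
      _ ≤ (1 - 1 / (2 * T)) * max a 0 + (1 / T) * W * (1 / (τ ^ 2 * e) + s * (T * η)) := by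
          gcongr
      _ = _ := by rw [hlast]
  · positivity


section Parameters
variable {a q c p : ℝ}

theorem sq_rpow_sub_le (hq1 : 1 / 2 ≤ q) (hq2 : q < 1) (ha1 : 0 < a) (ha2 : a ≤ 1 / (2 * q))
    (n : ℕ) : ((a * ((n + 1 : ℕ) : ℝ) + 1) ^ q) ^ 2 - (a * ((n + 1 : ℕ) : ℝ) + 1) ^ q ≤
      ((a * (n : ℝ) + 1) ^ q) ^ 2 := by
  have hA : 0 < a * (n : ℝ) + 1 := by positivity
  have hB1 : 1 ≤ a * ((n + 1 : ℕ) : ℝ) + 1 := by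
    have : 0 ≤ a * ((n + 1 : ℕ) : ℝ) := by positivity
    linarith
  have hAB : a * ((n + 1 : ℕ) : ℝ) + 1 = (a * (n : ℝ) + 1) + a := by push_cast; ring
  set A := a * (n : ℝ) + 1
  set B := a * ((n + 1 : ℕ) : ℝ) + 1
  have hB : 0 < B := by linarith
  have hsq : ∀ b : ℝ, 0 < b → (b ^ q) ^ 2 = b ^ (2 * q) := fun b hb => by
    rw [← Real.rpow_natCast, ← Real.rpow_mul hb.le]; congr 1; push_cast; ring
  rw [hsq A hA, hsq B hB]
  have hbern := one_add_mul_self_le_rpow_one_add (s := -(a / B))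
    (by rw [neg_le_neg_iff, div_le_one hB]; linarith) (show 1 ≤ 2 * q by linarith)
  have h1 : 1 + -(a / B) = A / B := by field_simp; linarith
  rw [h1, Real.div_rpow hA.le hB.le, le_div_iff₀ (by positivity)] at hbern
  have h2 : 2 * q * a ≤ 1 := by
    rw [le_div_iff₀ (by linarith)] at ha2
    linarith
  have h3 : B ^ (2 * q) / B = B ^ (2 * q - 1) := by rw [Real.rpow_sub_one hB.ne']
  have h4 : B ^ (2 * q - 1) ≤ B ^ q := Real.rpow_le_rpow_of_exponent_le hB1 (by linarith)
  have h5 : (1 + 2 * q * -(a / B)) * B ^ (2 * q) =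
      B ^ (2 * q) - 2 * q * a * (B ^ (2 * q) / B) := by ring
  rw [h5, h3] at hbern
  have h6 : 2 * q * a * B ^ (2 * q - 1) ≤ 1 * B ^ (2 * q - 1) := by gcongr
  linarith

theorem not_summable_one_div_rpow (hq2 : q ≤ 1) (ha : 0 < a) :
    ¬ Summable (fun n : ℕ => 1 / (a * (n : ℝ) + 1) ^ q) := by
  intro h
  have h1 : ¬ Summable (fun n : ℕ => 1 / ((n + 1 : ℕ) : ℝ)) := by
    rw [summable_nat_add_iff (f := fun n : ℕ => 1 / (n : ℝ)) 1]
    exact Real.not_summable_one_div_natCast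
  apply h1
  refine Summable.of_nonneg_of_le (fun n => by positivity) (fun n => ?_) (h.mul_left (a + 1))
  have hn : (0 : ℝ) ≤ n := n.cast_nonneg
  have hB1 : 1 ≤ a * (n : ℝ) + 1 := by
    have : 0 ≤ a * (n : ℝ) := by positivity
    linarith
  have h2 : (a * (n : ℝ) + 1) ^ q ≤ a * (n : ℝ) + 1 := by
    simpa using Real.rpow_le_rpow_of_exponent_le hB1 hq2
  have h3 : 0 < (a * (n : ℝ) + 1) ^ q := by positivity
  rw [mul_one_div, div_le_div_iff₀ (by positivity) h3]
  push_cast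
  nlinarith

theorem tendsto_rpow_mul_ratio_sub_one (hq0 : 0 ≤ q) (hq2 : q < 1) (ha : 0 < a) (hc : 0 < c)
    (hp1 : 0 < p) (hp2 : p ≤ 2) :
    Tendsto (fun n : ℕ => (a * ((n + 1 : ℕ) : ℝ) + 1) ^ q *
      (c / (n : ℝ) ^ p / (c / ((n + 1 : ℕ) : ℝ) ^ p) - 1)) atTop (𝓝 0) := by
  have hlim : Tendsto (fun n : ℕ => 3 * (2 * a + 1) ^ q * (n : ℝ) ^ (-(1 - q))) atTop (𝓝 0) := by
    simpa using ((tendsto_rpow_neg_atTop (show 0 < 1 - q by linarith)).comp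
      tendsto_natCast_atTop_atTop).const_mul (3 * (2 * a + 1) ^ q)
  refine squeeze_zero' ?_ ?_ hlim
  all_goals
    filter_upwards [eventually_ge_atTop 1] with n hn
    have hn1 : (1 : ℝ) ≤ n := by exact_mod_cast hn
    have hn0 : (0 : ℝ) < n := by linarith
    have hratio : c / (n : ℝ) ^ p / (c / ((n + 1 : ℕ) : ℝ) ^ p) = (1 + 1 / (n : ℝ)) ^ p := by
      have : 1 + 1 / (n : ℝ) = ((n + 1 : ℕ) : ℝ) / n := by push_cast; field_simp
      rw [this, Real.div_rpow (by positivity) hn0.le]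
      have h1 : 0 < (n : ℝ) ^ p := by positivity
      have h2 : 0 < ((n + 1 : ℕ) : ℝ) ^ p := by positivity
      field_simp
    rw [hratio]
    have hone : 1 ≤ 1 + 1 / (n : ℝ) := by
      have : 0 < 1 / (n : ℝ) := by positivity
      linarith
  · have := Real.one_le_rpow hone hp1.le
    apply mul_nonneg (by positivity) (by linarith)
  · have h1 : (1 + 1 / (n : ℝ)) ^ p ≤ (1 + 1 / (n : ℝ)) ^ (2 : ℝ) :=
      Real.rpow_le_rpow_of_exponent_le hone hp2
    rw [Real.rpow_two] at h1
    have h0 : 1 / (n : ℝ) ≤ 1 := by rw [div_le_one hn0]; exact hn1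
    have h0' : 0 < 1 / (n : ℝ) := by positivity
    have h2 : (1 + 1 / (n : ℝ)) ^ p - 1 ≤ 3 * (1 / (n : ℝ)) := by nlinarith
    have h3 : (a * ((n + 1 : ℕ) : ℝ) + 1) ^ q ≤ ((2 * a + 1) * n) ^ q := by
      apply Real.rpow_le_rpow (by positivity) _ hq0
      push_cast
      nlinarith
    rw [Real.mul_rpow (by positivity) hn0.le] at h3
    have h4 : (n : ℝ) ^ (-(1 - q)) = (n : ℝ) ^ q * (1 / (n : ℝ)) := by
      rw [neg_sub, Real.rpow_sub_one hn0.ne']; ring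
    rw [h4]
    calc _ ≤ ((2 * a + 1) ^ q * (n : ℝ) ^ q) * (3 * (1 / (n : ℝ))) := by
          apply mul_le_mul h3 h2 _ (by positivity)
          linarith [Real.one_le_rpow hone hp1.le]
      _ = _ := by ring

theorem tendsto_one_div_sq_rpow_mul (hq0 : 0 ≤ q) (ha : 0 < a) (hc : 0 < c) (hp2 : p < 2 * q) :
    Tendsto (fun n : ℕ => 1 / (((a * (n : ℝ) + 1) ^ q) ^ 2 * (c / ((n + 1 : ℕ) : ℝ) ^ p)))
      atTop (𝓝 0) := by
  set b := min a 1 with hb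
  have hb0 : 0 < b := lt_min ha one_pos
  have hlim : Tendsto (fun n : ℕ => 1 / (c * b ^ (2 * q)) *
      ((n + 1 : ℕ) : ℝ) ^ (-(2 * q - p))) atTop (𝓝 0) := by
    have h1 : Tendsto (fun n : ℕ => ((n + 1 : ℕ) : ℝ)) atTop atTop :=
      tendsto_natCast_atTop_atTop.comp (tendsto_add_atTop_nat 1)
    simpa using ((tendsto_rpow_neg_atTop (show 0 < 2 * q - p by linarith)).comp h1).const_mul
      (1 / (c * b ^ (2 * q)))
  refine squeeze_zero (fun n => by positivity) (fun n => ?_) hlim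
  have hN : 0 < ((n + 1 : ℕ) : ℝ) := by positivity
  have hA : 0 < a * (n : ℝ) + 1 := by positivity
  have hle : b * ((n + 1 : ℕ) : ℝ) ≤ a * (n : ℝ) + 1 := by
    have h1 : b ≤ a := min_le_left _ _
    have h2 : b ≤ 1 := min_le_right _ _
    have : (0 : ℝ) ≤ n := n.cast_nonneg
    push_cast
    nlinarith
  have hsq : ((a * (n : ℝ) + 1) ^ q) ^ 2 = (a * (n : ℝ) + 1) ^ (2 * q) := by
    rw [← Real.rpow_natCast, ← Real.rpow_mul hA.le]; congr 1; push_cast; ring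
  have h3 : b ^ (2 * q) * ((n + 1 : ℕ) : ℝ) ^ (2 * q) ≤ (a * (n : ℝ) + 1) ^ (2 * q) := by
    rw [← Real.mul_rpow hb0.le hN.le]
    exact Real.rpow_le_rpow (by positivity) hle (by linarith)
  rw [hsq]
  have h4 : 1 / (c * b ^ (2 * q)) * ((n + 1 : ℕ) : ℝ) ^ (-(2 * q - p)) =
      1 / (b ^ (2 * q) * ((n + 1 : ℕ) : ℝ) ^ (2 * q) * (c / ((n + 1 : ℕ) : ℝ) ^ p)) := by
    rw [Real.rpow_neg hN.le, Real.rpow_sub hN]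
    field_simp
  rw [h4]
  gcongr

end Parameters

section Hilbert
variable {H : Type*} [NormedAddCommGroup H] [InnerProductSpace ℝ H]

/-- Descent lemma: the quadratic upper bound of a function with Lipschitz gradient. -/
theorem le_add_inner_add_sq_of_gradient_lipschitz [CompleteSpace H] {g : H → ℝ} {g' : H → H} {L : ℝ}
    (hg : ∀ u, HasGradientAt g (g' u) u) (hlip : ∀ u v, ‖g' u - g' v‖ ≤ L * ‖u - v‖) (u v : H) :
    g v ≤ g u + ⟪g' u, v - u⟫ + L / 2 * ‖v - u‖ ^ 2 := by
  set d := v - u with hd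
  have hder : ∀ τ : ℝ, HasDerivAt
      (fun τ : ℝ => g (u + τ • d) - τ * ⟪g' u, d⟫ - L / 2 * ‖d‖ ^ 2 * τ ^ 2)
      (⟪g' (u + τ • d), d⟫ - ⟪g' u, d⟫ - L / 2 * ‖d‖ ^ 2 * (2 * τ)) τ := by
    intro τ
    have h1 : HasDerivAt (fun τ : ℝ => u + τ • d) d τ := by
      simpa using ((hasDerivAt_id τ).smul_const d).const_add u
    have h2 := (hg (u + τ • d)).hasFDerivAt.comp_hasDerivAt τ h1
    have h3 := (hasDerivAt_id τ).mul_const ⟪g' u, d⟫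
    have h4 := (hasDerivAt_pow 2 τ).const_mul (L / 2 * ‖d‖ ^ 2)
    exact ((h2.sub h3).sub h4).congr_deriv (by simp)
  have hanti : AntitoneOn
      (fun τ : ℝ => g (u + τ • d) - τ * ⟪g' u, d⟫ - L / 2 * ‖d‖ ^ 2 * τ ^ 2) (Set.Icc 0 1) := by
    apply antitoneOn_of_deriv_nonpos (convex_Icc 0 1)
    · exact fun τ _ => (hder τ).continuousAt.continuousWithinAt
    · exact fun τ _ => (hder τ).differentiableAt.differentiableWithinAt
    · intro τ hτ
      rw [interior_Icc] at hτ
      rw [(hder τ).deriv, ← inner_sub_left]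
      have h1 := real_inner_le_norm (g' (u + τ • d) - g' u) d
      have h2 := hlip (u + τ • d) u
      rw [add_sub_cancel_left, norm_smul, Real.norm_of_nonneg hτ.1.le] at h2
      have h3 := mul_le_mul_of_nonneg_right h2 (norm_nonneg d)
      nlinarith
  have h := hanti (Set.left_mem_Icc.2 zero_le_one) (Set.right_mem_Icc.2 zero_le_one) zero_le_one
  simp only [one_smul, zero_smul, add_zero, hd] at h
  rw [add_sub_cancel] at h
  simp only [hd]
  linarith

/-- A convex function lies above its tangents. -/
theorem add_inner_le_of_convexOn [CompleteSpace H] {g : H → ℝ} {g₀ u : H} (hc : ConvexOn ℝ Set.univ g)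
    (hg : HasGradientAt g g₀ u) (v : H) : g u + ⟪g₀, v - u⟫ ≤ g v := by
  have h1 : HasDerivAt (fun τ : ℝ => u + τ • (v - u)) (v - u) 0 := by
    simpa using ((hasDerivAt_id (0 : ℝ)).smul_const (v - u)).const_add u
  have hg' : HasGradientAt g g₀ (u + (0 : ℝ) • (v - u)) := by simpa using hg
  have h2 := hg'.hasFDerivAt.comp_hasDerivAt 0 h1
  have h3 : ConvexOn ℝ Set.univ (fun τ : ℝ => g (u + τ • (v - u))) := by
    have := hc.comp_affineMap (AffineMap.lineMap u v : ℝ →ᵃ[ℝ] H)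
    have heq : (fun τ : ℝ => g (u + τ • (v - u))) = g ∘ (AffineMap.lineMap u v : ℝ →ᵃ[ℝ] H) := by
      ext τ
      simp [AffineMap.lineMap_apply, add_comm]
    rw [heq]
    exact this
  have h4 := h3.le_slope_of_hasDerivAt (Set.mem_univ 0) (Set.mem_univ 1) one_pos h2
  simp [slope_def_field] at h4
  linarith

/-- Variational inequality for a minimizer of `φ + ‖· - z‖² / (2σ)`. -/
theorem add_inner_le_of_prox {D : Set H} {φ : H → ℝ} (hφ : ConvexOn ℝ D φ) {σ : ℝ} (hσ : 0 < σ)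
    {z p : H} (hp : p ∈ D)
    (hmin : ∀ u ∈ D, φ p + ‖p - z‖ ^ 2 / (2 * σ) ≤ φ u + ‖u - z‖ ^ 2 / (2 * σ))
    {w : H} (hw : w ∈ D) : φ p + ⟪σ⁻¹ • (z - p), w - p⟫ ≤ φ w := by
  have key : ∀ τ : ℝ, 0 < τ → τ ≤ 1 →
      φ p + ⟪σ⁻¹ • (z - p), w - p⟫ - φ w ≤ τ * (‖w - p‖ ^ 2 / (2 * σ)) := by
    intro τ h0 h1
    have hmem := hφ.1 hp hw (sub_nonneg.2 h1) h0.le (by ring)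
    have h2 := hmin _ hmem
    have h3 := hφ.2 hp hw (sub_nonneg.2 h1) h0.le (by ring)
    have h4 : ‖(1 - τ) • p + τ • w - z‖ ^ 2 =
        ‖p - z‖ ^ 2 - 2 * τ * ⟪z - p, w - p⟫ + τ ^ 2 * ‖w - p‖ ^ 2 := by
      have : (1 - τ) • p + τ • w - z = τ • (w - p) - (z - p) := by module
      rw [this, norm_sub_sq_real, norm_smul, inner_smul_left, norm_sub_rev p z,
        Real.norm_of_nonneg h0.le, real_inner_comm]
      simp
      ring
    rw [h4] at h2
    simp only [smul_eq_mul] at h3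
    rw [inner_smul_left]
    simp only [RCLike.conj_to_real]
    have h5 : τ * (φ p + σ⁻¹ * ⟪z - p, w - p⟫ - φ w) ≤ τ * (τ * (‖w - p‖ ^ 2 / (2 * σ))) := by
      have h6 : (‖p - z‖ ^ 2 - 2 * τ * ⟪z - p, w - p⟫ + τ ^ 2 * ‖w - p‖ ^ 2) / (2 * σ) =
        ‖p - z‖ ^ 2 / (2 * σ) - τ * (σ⁻¹ * ⟪z - p, w - p⟫) +
          τ * (τ * (‖w - p‖ ^ 2 / (2 * σ))) := by field_simp
      rw [h6] at h2
      linarith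
    exact le_of_mul_le_mul_left h5 h0
  have hlim : Tendsto (fun τ : ℝ => τ * (‖w - p‖ ^ 2 / (2 * σ))) (𝓝[>] 0) (𝓝 0) := by
    have : Tendsto (fun τ : ℝ => τ * (‖w - p‖ ^ 2 / (2 * σ))) (𝓝 0)
      (𝓝 (0 * (‖w - p‖ ^ 2 / (2 * σ)))) := tendsto_id.mul_const _
    rw [zero_mul] at this
    exact this.mono_left nhdsWithin_le_nhds
  have := ge_of_tendsto hlim (b := φ p + ⟪σ⁻¹ • (z - p), w - p⟫ - φ w) (by
    filter_upwards [Ioc_mem_nhdsGT (show (0 : ℝ) < 1 by norm_num)] with τ hτ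
    exact key τ hτ.1 hτ.2)
  linarith

/-- The Tikhonov regularization of `ψ` with parameter `e`. -/
noncomputable def tikhonov (ψ : H → ℝ) (e : ℝ) (u : H) : ℝ := ψ u + e / 2 * ‖u‖ ^ 2

/-- One proximal gradient step on the Tikhonov regularization. -/
theorem tikhonov_prox_grad_step [CompleteSpace H] {D : Set H} {φ g : H → ℝ} {g' : H → H}
    {L s e : ℝ} (hgc : ConvexOn ℝ Set.univ g)
    (hg : ∀ u, HasGradientAt g (g' u) u) (hlip : ∀ u v, ‖g' u - g' v‖ ≤ L * ‖u - v‖)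
    (hs : 0 < s) (he : 0 ≤ e) (hse : s * (L + e) ≤ 1) {p y : H}
    (hp : ∀ u ∈ D, φ p + ⟪s⁻¹ • (y - s • g' y - (s * e) • y - p), u - p⟫ ≤ φ u)
    {u : H} (hu : u ∈ D) :
    2 * s * (tikhonov (fun v => φ v + g v) e p - tikhonov (fun v => φ v + g v) e u) ≤
      ‖y - u‖ ^ 2 - ‖p - u‖ ^ 2 := by
  have h1 := hp u hu
  have h2 := le_add_inner_add_sq_of_gradient_lipschitz hg hlip y p
  have h3 := add_inner_le_of_convexOn hgc (hg y) u
  have e1 : s⁻¹ • (y - s • g' y - (s * e) • y - p) = s⁻¹ • (y - p) - g' y - e • y := by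
    rw [smul_sub, smul_sub, smul_sub, smul_smul, smul_smul, inv_mul_cancel₀ hs.ne',
      inv_mul_cancel_left₀ hs.ne', smul_sub, one_smul]
    abel
  rw [e1, inner_sub_left, inner_sub_left, inner_smul_left, inner_smul_left] at h1
  simp only [RCLike.conj_to_real] at h1
  have e2 : ⟪g' y, u - p⟫ = ⟪g' y, u - y⟫ - ⟪g' y, p - y⟫ := by
    rw [← inner_sub_right]; congr 1; abel
  have e3 : ⟪y - p, u - p⟫ = (‖y - p‖ ^ 2 + ‖p - u‖ ^ 2 - ‖y - u‖ ^ 2) / 2 := by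
    have : y - u = (y - p) - (u - p) := by abel
    rw [this, norm_sub_sq_real (y - p) (u - p), norm_sub_rev p u]; ring
  have e4 : ‖u‖ ^ 2 = ‖y‖ ^ 2 + 2 * ⟪y, u - y⟫ + ‖u - y‖ ^ 2 := by
    rw [← norm_add_sq_real]; congr 2; abel
  have e5 : ‖p‖ ^ 2 = ‖y‖ ^ 2 + 2 * ⟪y, p - y⟫ + ‖p - y‖ ^ 2 := by
    rw [← norm_add_sq_real]; congr 2; abel
  have e6 : ⟪y, u - p⟫ = ⟪y, u - y⟫ - ⟪y, p - y⟫ := by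
    rw [← inner_sub_right]; congr 1; abel
  rw [e2, e3, e6] at h1
  simp only [tikhonov]
  rw [e4, e5]
  rw [norm_sub_rev p y] at *
  have h5 : s⁻¹ * ((‖y - p‖ ^ 2 + ‖p - u‖ ^ 2 - ‖y - u‖ ^ 2) / 2) * (2 * s) =
    ‖y - p‖ ^ 2 + ‖p - u‖ ^ 2 - ‖y - u‖ ^ 2 := by field_simp
  have h6 : 0 ≤ s * e * ‖u - y‖ ^ 2 := by positivity
  have h7 : s * (L + e) * ‖y - p‖ ^ 2 ≤ 1 * ‖y - p‖ ^ 2 := by gcongr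
  have h8 := mul_le_mul_of_nonneg_left (add_le_add (add_le_add h1 h2) h3)
    (show 0 ≤ 2 * s by positivity)
  nlinarith

/-- Energy estimate for one step of the inertial scheme. -/
theorem tikhonov_energy_step {D : Set H} {ψ : H → ℝ} (hψ : ConvexOn ℝ D ψ)
    {s e₀ e₁ τ T : ℝ} (hs : 0 < s) (he₁ : 0 ≤ e₁) (he : e₁ ≤ e₀) (hτ : 1 ≤ τ) (hT : 1 ≤ T)
    (hθ : T ^ 2 - T ≤ τ ^ 2) {x₁ x₂ y z w : H} (hx₁ : x₁ ∈ D) (hw : w ∈ D)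
    (hy : y = x₁ - (1 / T) • x₁ + ((T ^ 2 - T) / τ ^ 2 / T) • z)
    (hstep : ∀ u ∈ D, 2 * s * (tikhonov ψ e₁ x₂ - tikhonov ψ e₁ u) ≤
      ‖y - u‖ ^ 2 - ‖x₂ - u‖ ^ 2) :
    2 * s * T ^ 2 * (tikhonov ψ e₁ x₂ - tikhonov ψ e₁ w) + ‖T • x₂ - (T - 1) • x₁ - w‖ ^ 2 ≤
      (T ^ 2 - T) / τ ^ 2 *
        (2 * s * τ ^ 2 * (tikhonov ψ e₀ x₁ - tikhonov ψ e₀ w) + ‖z - w‖ ^ 2)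
      + (1 - (T ^ 2 - T) / τ ^ 2) * ‖w‖ ^ 2
      + s * (T ^ 2 - T) * (e₀ - e₁) * ‖w‖ ^ 2 := by
  have hT0 : 0 < T := by linarith
  have hτ0 : 0 < τ := by linarith
  have hTT : 0 ≤ T ^ 2 - T := by nlinarith
  have hθ0 : 0 ≤ (T ^ 2 - T) / τ ^ 2 := by positivity
  have hθ1 : (T ^ 2 - T) / τ ^ 2 ≤ 1 := by rw [div_le_one (by positivity)]; exact hθ
  have hθτ : (T ^ 2 - T) / τ ^ 2 * τ ^ 2 = T ^ 2 - T := by field_simp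
  set θ := (T ^ 2 - T) / τ ^ 2 with hθdef
  clear_value θ
  have hT1 : 0 ≤ 1 - 1 / T := by rw [sub_nonneg, div_le_one hT0]; exact hT
  have hT2 : 0 ≤ 1 / T := by positivity
  have hu := hψ.1 hx₁ hw hT1 hT2 (by ring)
  have hψu := hψ.2 hx₁ hw hT1 hT2 (by ring)
  have hsq : ∀ v v' : H, ∀ b : ℝ, 0 ≤ b → b ≤ 1 →
      ‖(1 - b) • v + b • v'‖ ^ 2 ≤ (1 - b) * ‖v‖ ^ 2 + b * ‖v'‖ ^ 2 := by
    intro v v' b h0 h1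
    have hcv : ‖(1 - b) • v + b • v'‖ ^ 2 =
        (1 - b) * ‖v‖ ^ 2 + b * ‖v'‖ ^ 2 - b * (1 - b) * ‖v - v'‖ ^ 2 := by
      rw [norm_add_sq_real, norm_sub_sq_real, norm_smul, norm_smul, inner_smul_left,
        inner_smul_right, Real.norm_of_nonneg h0, Real.norm_of_nonneg (sub_nonneg.2 h1)]
      simp only [RCLike.conj_to_real]
      ring
    have : 0 ≤ b * (1 - b) * ‖v - v'‖ ^ 2 :=
      mul_nonneg (mul_nonneg h0 (sub_nonneg.2 h1)) (sq_nonneg _)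
    linarith
  have hnu := hsq x₁ w (1 / T) hT2 (by linarith)
  have hs1 := hstep _ hu
  set u := (1 - 1 / T) • x₁ + (1 / T) • w with hudef
  have e1 : θ • z - w = T • (y - u) := by
    rw [hy, hudef]
    match_scalars
    all_goals field_simp
    all_goals ring
  have e2 : T • x₂ - (T - 1) • x₁ - w = T • (x₂ - u) := by
    rw [hudef]
    match_scalars <;> field_simp
  have e3 : θ • z - w = (1 - θ) • (-w) + θ • (z - w) := by module
  have h1 := hsq (-w) (z - w) θ hθ0 hθ1
  rw [← e3, e1, norm_smul, mul_pow, norm_neg, Real.norm_of_nonneg hT0.le] at h1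
  rw [e2, norm_smul, mul_pow, Real.norm_of_nonneg hT0.le]
  simp only [smul_eq_mul] at hψu
  have hΦ : tikhonov ψ e₁ u ≤ (1 - 1 / T) * tikhonov ψ e₁ x₁ + (1 / T) * tikhonov ψ e₁ w := by
    simp only [tikhonov]
    have := mul_le_mul_of_nonneg_left hnu (show 0 ≤ e₁ / 2 by linarith)
    linarith
  have h2 := mul_le_mul_of_nonneg_left hΦ (show 0 ≤ 2 * s * T ^ 2 by positivity)
  have h3 : 2 * s * T ^ 2 * ((1 - 1 / T) * tikhonov ψ e₁ x₁ + (1 / T) * tikhonov ψ e₁ w) =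
      2 * s * (T ^ 2 - T) * tikhonov ψ e₁ x₁ + 2 * s * T * tikhonov ψ e₁ w := by
    field_simp
  have h4 := mul_le_mul_of_nonneg_left hs1 (sq_nonneg T)
  have h5 : tikhonov ψ e₁ x₁ - tikhonov ψ e₁ w ≤
      tikhonov ψ e₀ x₁ - tikhonov ψ e₀ w + (e₀ - e₁) / 2 * ‖w‖ ^ 2 := by
    simp only [tikhonov]
    have : 0 ≤ (e₀ - e₁) / 2 * ‖x₁‖ ^ 2 := mul_nonneg (by linarith) (sq_nonneg _)
    linarith
  have h6 := mul_le_mul_of_nonneg_left h5 (show 0 ≤ 2 * s * (T ^ 2 - T) by positivity)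
  have h7 : θ * (2 * s * τ ^ 2 * (tikhonov ψ e₀ x₁ - tikhonov ψ e₀ w) + ‖z - w‖ ^ 2) =
      2 * s * (T ^ 2 - T) * (tikhonov ψ e₀ x₁ - tikhonov ψ e₀ w) + θ * ‖z - w‖ ^ 2 := by
    rw [← hθτ]; ring
  rw [h7]
  linarith

/-- Quadratic growth at a minimizer of the Tikhonov regularization. -/
theorem tikhonov_quadratic_growth {D : Set H} {ψ : H → ℝ} (hψ : ConvexOn ℝ D ψ) {e : ℝ}
    {m u : H} (hm : m ∈ D) (hu : u ∈ D) (hmin : ∀ v ∈ D, tikhonov ψ e m ≤ tikhonov ψ e v) :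
    e / 4 * ‖u - m‖ ^ 2 ≤ tikhonov ψ e u - tikhonov ψ e m := by
  have hmem := hψ.1 hm hu (show (0 : ℝ) ≤ 1 / 2 by norm_num) (show (0 : ℝ) ≤ 1 / 2 by norm_num)
    (by norm_num)
  have h1 := hψ.2 hm hu (show (0 : ℝ) ≤ 1 / 2 by norm_num) (show (0 : ℝ) ≤ 1 / 2 by norm_num)
    (by norm_num)
  have h2 := hmin _ hmem
  have h3 : ‖(1 / 2 : ℝ) • m + (1 / 2 : ℝ) • u‖ ^ 2 =
      ‖m‖ ^ 2 / 2 + ‖u‖ ^ 2 / 2 - ‖u - m‖ ^ 2 / 4 := by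
    rw [← smul_add, norm_smul, mul_pow, norm_add_sq_real, norm_sub_sq_real, real_inner_comm]
    norm_num
    ring
  simp only [tikhonov, smul_eq_mul] at *
  rw [h3] at h2
  linarith

/-- Minimizers of the Tikhonov regularizations form a convergent sequence. -/
theorem exists_tendsto_tikhonov_minimizer [CompleteSpace H] {D : Set H} {ψ : H → ℝ}
    (hψ : ConvexOn ℝ D ψ)
    {e : ℕ → ℝ} (he : ∀ n, 0 < e n) (hanti : StrictAnti e) {m : ℕ → H} (hm : ∀ n, m n ∈ D)
    (hmin : ∀ n, ∀ v ∈ D, tikhonov ψ (e n) (m n) ≤ tikhonov ψ (e n) v)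
    {v : H} (hv : v ∈ D) (hvmin : ∀ u ∈ D, ψ v ≤ ψ u) :
    ∃ w, Tendsto m atTop (𝓝 w) := by
  have hpair : ∀ k l, k < l → ‖m l - m k‖ ^ 2 ≤ 2 * (‖m l‖ ^ 2 - ‖m k‖ ^ 2) := by
    intro k l hkl
    have h1 := tikhonov_quadratic_growth hψ (hm k) (hm l) (hmin k)
    have h2 := hmin l (m k) (hm k)
    have h3 := hanti hkl
    have h4 := he l
    have h5 := he k
    simp only [tikhonov] at h1 h2
    have h6 : e k / 4 * ‖m l - m k‖ ^ 2 ≤ (e k - e l) / 2 * (‖m l‖ ^ 2 - ‖m k‖ ^ 2) := by linarith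
    have h7 : 0 ≤ e k / 4 * ‖m l - m k‖ ^ 2 := by positivity
    have h8 : 0 ≤ ‖m l‖ ^ 2 - ‖m k‖ ^ 2 :=
      nonneg_of_mul_nonneg_right (h7.trans h6) (by linarith)
    have h9 : e k / 4 * ‖m l - m k‖ ^ 2 ≤ e k / 4 * (2 * (‖m l‖ ^ 2 - ‖m k‖ ^ 2)) := by
      nlinarith [mul_nonneg h4.le h8]
    exact le_of_mul_le_mul_left h9 (by positivity)
  have hmono : Monotone fun n => ‖m n‖ ^ 2 := by
    refine monotone_nat_of_le_succ fun n => ?_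
    have := hpair n (n + 1) (Nat.lt_succ_self n)
    nlinarith [sq_nonneg ‖m (n + 1) - m n‖]
  have hbdd : BddAbove (Set.range fun n => ‖m n‖ ^ 2) := by
    refine ⟨‖v‖ ^ 2, ?_⟩
    rintro _ ⟨n, rfl⟩
    have h1 := hmin n v hv
    have h2 := hvmin _ (hm n)
    simp only [tikhonov] at h1
    have h3 : e n / 2 * ‖m n‖ ^ 2 ≤ e n / 2 * ‖v‖ ^ 2 := by linarith
    exact le_of_mul_le_mul_left h3 (by linarith [he n])
  have hlim := tendsto_atTop_ciSup hmono hbdd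
  set S := ⨆ n, ‖m n‖ ^ 2
  apply cauchySeq_tendsto_of_complete
  refine cauchySeq_of_le_tendsto_0 (fun n => Real.sqrt (2 * (S - ‖m n‖ ^ 2)) +
    Real.sqrt (2 * (S - ‖m n‖ ^ 2))) ?_ ?_
  · intro k l N hk hl
    have aux : ∀ j, N ≤ j → dist (m j) (m N) ≤ Real.sqrt (2 * (S - ‖m N‖ ^ 2)) := by
      intro j hj
      apply Real.le_sqrt_of_sq_le
      have hS : ‖m j‖ ^ 2 ≤ S := le_ciSup hbdd j
      rw [dist_eq_norm]
      rcases hj.eq_or_lt with rfl | hlt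
      · simpa using hS
      · linarith [hpair N j hlt]
    calc dist (m k) (m l) ≤ dist (m k) (m N) + dist (m l) (m N) := dist_triangle_right _ _ _
      _ ≤ _ := add_le_add (aux k hk) (aux l hl)
  · have h1 : Tendsto (fun n => 2 * (S - ‖m n‖ ^ 2)) atTop (𝓝 0) := by
      simpa using (hlim.const_sub S).const_mul 2
    have h2 := (Real.continuous_sqrt.tendsto 0).comp h1
    rw [Real.sqrt_zero] at h2
    simpa using h2.add h2

/-- Convergence rates of an inertial proximal scheme with vanishing Tikhonov regularization. -/
theorem tikhonov_inertial_rates {D : Set H} {ψ : H → ℝ} (hψ : ConvexOn ℝ D ψ) {s : ℝ} (hs : 0 < s)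
    {t ε : ℕ → ℝ} (ht1 : ∀ n, 1 ≤ t n) (htmono : ∀ n, t n ≤ t (n + 1))
    (htsq : ∀ n, t (n + 1) ^ 2 - t (n + 1) ≤ t n ^ 2)
    (hε : ∀ n, 1 ≤ n → 0 < ε n) (hεanti : ∀ n, 1 ≤ n → ε (n + 1) ≤ ε n)
    (hη : Tendsto (fun n => t (n + 1) * (ε n / ε (n + 1) - 1)) atTop (𝓝 0))
    (hinv : Tendsto (fun n => 1 / (t n ^ 2 * ε (n + 1))) atTop (𝓝 0))
    (hsum : ¬ Summable (fun n => 1 / t n))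
    {x y m : ℕ → H} {w : H} (hw : w ∈ D) (hwmin : ∀ u ∈ D, ψ w ≤ ψ u)
    (hmD : ∀ n, 1 ≤ n → m n ∈ D)
    (hmin : ∀ n, 1 ≤ n → ∀ u ∈ D, tikhonov ψ (ε n) (m n) ≤ tikhonov ψ (ε n) u)
    (hmlim : Tendsto m atTop (𝓝 w))
    (hxD : ∀ n, 1 ≤ n → x (n + 1) ∈ D)
    (hy : ∀ n, y (n + 1) = x (n + 1) - (1 / t (n + 1)) • x (n + 1)
      + ((t (n + 1) ^ 2 - t (n + 1)) / t n ^ 2 / t (n + 1)) •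
        (t n • x (n + 1) - (t n - 1) • x n))
    (hstep : ∀ᶠ n in atTop, ∀ u ∈ D,
      2 * s * (tikhonov ψ (ε n) (x (n + 1)) - tikhonov ψ (ε n) u) ≤
        ‖y n - u‖ ^ 2 - ‖x (n + 1) - u‖ ^ 2) :
    Tendsto (fun n => (tikhonov ψ (ε n) (x n) - tikhonov ψ (ε n) (m n)) / ε n) atTop (𝓝 0) ∧
    Tendsto x atTop (𝓝 w) ∧
    Tendsto (fun n => ‖x (n + 1) - x n‖ / √(ε (n + 1))) atTop (𝓝 0) ∧
    Tendsto (fun n => ‖x (n + 1) - y n‖ / √(ε (n + 1))) atTop (𝓝 0) ∧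
    Tendsto (fun n => ε n / ε (n + 1)) atTop (𝓝 1) := by
  have ht0 : ∀ n, 0 < t n := fun n => lt_of_lt_of_le one_pos (ht1 n)
  set z : ℕ → H := fun n => t n • x (n + 1) - (t n - 1) • x n with hz
  set A : ℕ → ℝ := fun n =>
    2 * s * t n ^ 2 * (tikhonov ψ (ε n) (x (n + 1)) - tikhonov ψ (ε n) w) + ‖z n - w‖ ^ 2 with hAdef
  have hA : ∀ᶠ n in atTop, A (n + 1) ≤ (t (n + 1) ^ 2 - t (n + 1)) / t n ^ 2 * A n
      + (1 - (t (n + 1) ^ 2 - t (n + 1)) / t n ^ 2) * ‖w‖ ^ 2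
      + s * (t (n + 1) ^ 2 - t (n + 1)) * (ε n - ε (n + 1)) * ‖w‖ ^ 2 := by
    filter_upwards [(tendsto_add_atTop_nat 1).eventually hstep, eventually_ge_atTop 1] with n hn h1
    exact tikhonov_energy_step hψ hs (hε (n + 1) (by omega)).le (hεanti n h1) (ht1 n)
      (ht1 (n + 1)) (htsq n) (hxD n h1) hw (hy n) hn
  have hR := tendsto_posPart_energy_ratio (sq_nonneg ‖w‖) ht1 htmono hε hεanti hη hinv hsum hs hA
  set R : ℕ → ℝ := fun n => max (A n / (t n ^ 2 * ε n)) 0 with hRdef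
  have hAR : ∀ n, 1 ≤ n → A n ≤ R n * (t n ^ 2 * ε n) := fun n hn => by
    have h1 := hε n hn
    have h2 := ht0 n
    rw [← div_le_iff₀ (by positivity)]
    exact le_max_left _ _
  have hmgap : Tendsto (fun n => ‖w‖ ^ 2 - ‖m n‖ ^ 2) atTop (𝓝 0) := by
    have h1 := (hmlim.norm.pow 2).const_sub (‖w‖ ^ 2)
    rwa [sub_self] at h1
  have hη' : Tendsto (fun n => ε n / ε (n + 1) - 1) atTop (𝓝 0) := by
    refine squeeze_zero' ?_ ?_ hη
    all_goals
      filter_upwards [eventually_ge_atTop 1] with n hn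
      have h1 : 0 ≤ ε n / ε (n + 1) - 1 := by
        rw [sub_nonneg, one_le_div (hε (n + 1) (by omega))]; exact hεanti n hn
    · exact h1
    · exact le_mul_of_one_le_left h1 (ht1 _)
  have hratio : Tendsto (fun n => ε n / ε (n + 1)) atTop (𝓝 1) := by
    simpa using hη'.add_const 1
  have hwgap : ∀ n, 1 ≤ n → tikhonov ψ (ε n) w - tikhonov ψ (ε n) (m n) ≤
      ε n / 2 * (‖w‖ ^ 2 - ‖m n‖ ^ 2) := fun n hn => by
    have := hwmin _ (hmD n hn)
    simp only [tikhonov]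
    linarith
  have hgap : Tendsto (fun n => (tikhonov ψ (ε n) (x n) - tikhonov ψ (ε n) (m n)) / ε n)
      atTop (𝓝 0) := by
    rw [← tendsto_add_atTop_iff_nat 1]
    have hlim : Tendsto (fun n => ε n / ε (n + 1) * (R n / (2 * s))
        + (ε n / ε (n + 1) - 1) * (‖w‖ ^ 2 / 2) + (‖w‖ ^ 2 - ‖m (n + 1)‖ ^ 2) / 2)
        atTop (𝓝 0) := by
      have h1 := hmgap.comp (tendsto_add_atTop_nat 1)
      simpa using ((hratio.mul (hR.div_const (2 * s))).add (hη'.mul_const (‖w‖ ^ 2 / 2))).add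
        (h1.div_const 2)
    refine squeeze_zero' ?_ ?_ hlim
    · filter_upwards [eventually_ge_atTop 1] with n hn
      have := hmin (n + 1) (by omega) _ (hxD n hn)
      exact div_nonneg (by linarith) (hε _ (by omega)).le
    · filter_upwards [eventually_ge_atTop 1] with n hn
      have he0 := hε n hn
      have he1 := hε (n + 1) (by omega)
      have hT := ht0 n
      rw [div_le_iff₀ he1]
      have h1 := hwgap (n + 1) (by omega)
      have h2 : tikhonov ψ (ε n) (x (n + 1)) - tikhonov ψ (ε n) w ≤ ε n * (R n / (2 * s)) := by
        have h3 := hAR n hn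
        have h4 : 2 * s * t n ^ 2 * (tikhonov ψ (ε n) (x (n + 1)) - tikhonov ψ (ε n) w) ≤
            2 * s * t n ^ 2 * (ε n * (R n / (2 * s))) := by
          have h5 : 2 * s * t n ^ 2 * (ε n * (R n / (2 * s))) = R n * (t n ^ 2 * ε n) := by
            field_simp
          rw [h5]
          simp only [hAdef] at h3
          linarith [sq_nonneg ‖z n - w‖]
        exact le_of_mul_le_mul_left h4 (by positivity)
      have h6 : (ε n / ε (n + 1) * (R n / (2 * s))
          + (ε n / ε (n + 1) - 1) * (‖w‖ ^ 2 / 2) + (‖w‖ ^ 2 - ‖m (n + 1)‖ ^ 2) / 2) * ε (n + 1) =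
          ε n * (R n / (2 * s)) + (ε n - ε (n + 1)) / 2 * ‖w‖ ^ 2
            + ε (n + 1) / 2 * (‖w‖ ^ 2 - ‖m (n + 1)‖ ^ 2) := by
        field_simp
      rw [h6]
      have h7 : 0 ≤ (ε n - ε (n + 1)) / 2 * ‖x (n + 1)‖ ^ 2 :=
        mul_nonneg (by linarith [hεanti n hn]) (sq_nonneg _)
      simp only [tikhonov] at h1 h2 ⊢
      linarith
  have hxlim : Tendsto x atTop (𝓝 w) := by
    have h1 : Tendsto (fun n => ‖x n - m n‖) atTop (𝓝 0) := by
      have h2 : Tendsto (fun n => √(4 * ((tikhonov ψ (ε n) (x n) - tikhonov ψ (ε n) (m n)) / ε n)))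
          atTop (𝓝 0) := by
        simpa using (hgap.const_mul 4).sqrt
      refine squeeze_zero' (Eventually.of_forall fun n => norm_nonneg _) ?_ h2
      filter_upwards [eventually_ge_atTop 2] with n hn
      obtain ⟨k, rfl⟩ : ∃ k, n = k + 1 := ⟨n - 1, by omega⟩
      have he := hε (k + 1) (by omega)
      apply Real.le_sqrt_of_sq_le
      have h3 := tikhonov_quadratic_growth hψ (hmD (k + 1) (by omega)) (hxD k (by omega))
        (hmin (k + 1) (by omega))
      rw [← mul_div_assoc, le_div_iff₀ he]
      linarith
    simpa using (tendsto_zero_iff_norm_tendsto_zero.2 h1).add hmlim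
  have hsqrtinv : Tendsto (fun n => 1 / (t n * √(ε (n + 1)))) atTop (𝓝 0) := by
    have h1 := hinv.sqrt
    rw [Real.sqrt_zero] at h1
    refine h1.congr fun n => ?_
    rw [Real.sqrt_div zero_le_one, Real.sqrt_one, Real.sqrt_mul (sq_nonneg _),
      Real.sqrt_sq (ht0 n).le]
  have hzw : Tendsto (fun n => ‖z n - w‖ / (t n * √(ε (n + 1)))) atTop (𝓝 0) := by
    have hlim : Tendsto (fun n => √((R n + s * (‖w‖ ^ 2 - ‖m n‖ ^ 2)) * (ε n / ε (n + 1))))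
        atTop (𝓝 0) := by
      simpa using ((hR.add (hmgap.const_mul s)).mul hratio).sqrt
    refine squeeze_zero' (Eventually.of_forall fun n => ?_) ?_ hlim
    · have := ht0 n; positivity
    filter_upwards [eventually_ge_atTop 1] with n hn
    have he0 := hε n hn
    have he1 := hε (n + 1) (by omega)
    have hT := ht0 n
    apply Real.le_sqrt_of_sq_le
    rw [div_pow, mul_pow, Real.sq_sqrt he1.le, div_le_iff₀ (by positivity)]
    have h6 : (R n + s * (‖w‖ ^ 2 - ‖m n‖ ^ 2)) * (ε n / ε (n + 1)) * (t n ^ 2 * ε (n + 1)) =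
        R n * (t n ^ 2 * ε n) + 2 * s * t n ^ 2 * (ε n / 2 * (‖w‖ ^ 2 - ‖m n‖ ^ 2)) := by
      field_simp
    rw [h6]
    have h1 := hAR n hn
    have h2 : tikhonov ψ (ε n) w - tikhonov ψ (ε n) (x (n + 1)) ≤
        ε n / 2 * (‖w‖ ^ 2 - ‖m n‖ ^ 2) := by
      linarith [hwgap n hn, hmin n hn _ (hxD n hn)]
    have h3 := mul_le_mul_of_nonneg_left h2 (show 0 ≤ 2 * s * t n ^ 2 by positivity)
    simp only [hAdef] at h1
    linarith
  have hzero : ∀ v : ℕ → H, Tendsto v atTop (𝓝 w) →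
      Tendsto (fun n => ‖z n - w‖ / (t n * √(ε (n + 1)))
        + (‖w‖ + ‖v n‖) * (1 / (t n * √(ε (n + 1))))) atTop (𝓝 0) := fun v hv => by
    simpa using hzw.add ((hv.norm.const_add ‖w‖).mul hsqrtinv)
  have hvel : Tendsto (fun n => ‖x (n + 1) - x n‖ / √(ε (n + 1))) atTop (𝓝 0) := by
    refine squeeze_zero' (Eventually.of_forall fun n => by positivity) ?_ (hzero x hxlim)
    filter_upwards [eventually_ge_atTop 1] with n hn
    have he1 := Real.sqrt_pos.2 (hε (n + 1) (by omega))
    have hT := ht0 n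
    have h1 : t n * ‖x (n + 1) - x n‖ ≤ ‖z n - w‖ + (‖w‖ + ‖x n‖) := by
      have h2 : t n • (x (n + 1) - x n) = (z n - w) + (w - x n) := by
        simp only [hz]; module
      have h3 : ‖t n • (x (n + 1) - x n)‖ = t n * ‖x (n + 1) - x n‖ := by
        rw [norm_smul, Real.norm_of_nonneg hT.le]
      rw [← h3, h2]
      exact (norm_add_le _ _).trans (by gcongr; exact norm_sub_le _ _)
    rw [mul_one_div, ← add_div, div_le_div_iff₀ he1 (by positivity)]
    calc _ = t n * ‖x (n + 1) - x n‖ * √(ε (n + 1)) := by ring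
      _ ≤ _ := by gcongr
  refine ⟨hgap, hxlim, hvel, ?_, hratio⟩
  have hyx : Tendsto (fun n => ‖y (n + 1) - x (n + 1)‖ / √(ε (n + 1))) atTop (𝓝 0) := by
    refine squeeze_zero' (Eventually.of_forall fun n => by positivity) ?_
      (hzero _ (hxlim.comp (tendsto_add_atTop_nat 1)))
    filter_upwards [eventually_ge_atTop 1] with n hn
    have he1 := Real.sqrt_pos.2 (hε (n + 1) (by omega))
    have hT := ht0 n
    have hT1 := ht0 (n + 1)
    have hT1' := ht1 (n + 1)
    have hθ0 : 0 ≤ (t (n + 1) ^ 2 - t (n + 1)) / t n ^ 2 :=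
      div_nonneg (by nlinarith) (sq_nonneg _)
    have hθ1 : (t (n + 1) ^ 2 - t (n + 1)) / t n ^ 2 ≤ 1 := by
      rw [div_le_one (by positivity)]; exact htsq n
    have h1 : t n * ‖y (n + 1) - x (n + 1)‖ ≤ ‖z n - w‖ + (‖w‖ + ‖x (n + 1)‖) := by
      have h2 : t (n + 1) • (y (n + 1) - x (n + 1)) =
          ((t (n + 1) ^ 2 - t (n + 1)) / t n ^ 2) • ((z n - w) + w) - x (n + 1) := by
        rw [hy n, sub_add_cancel]
        change _ = ((t (n + 1) ^ 2 - t (n + 1)) / t n ^ 2) •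
          (t n • x (n + 1) - (t n - 1) • x n) - x (n + 1)
        generalize t n • x (n + 1) - (t n - 1) • x n = z₀
        match_scalars
        all_goals field_simp
        all_goals ring
      calc t n * ‖y (n + 1) - x (n + 1)‖ ≤ t (n + 1) * ‖y (n + 1) - x (n + 1)‖ := by
            gcongr; exact htmono n
        _ = ‖t (n + 1) • (y (n + 1) - x (n + 1))‖ := by
            rw [norm_smul, Real.norm_of_nonneg hT1.le]
        _ ≤ 1 * (‖z n - w‖ + ‖w‖) + ‖x (n + 1)‖ := by
            rw [h2]
            refine (norm_sub_le _ _).trans ?_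
            rw [norm_smul, Real.norm_of_nonneg hθ0]
            gcongr
            exact norm_add_le _ _
        _ = _ := by ring
    simp only [Function.comp_apply]
    rw [mul_one_div, ← add_div, div_le_div_iff₀ he1 (by positivity)]
    calc _ = t n * ‖y (n + 1) - x (n + 1)‖ * √(ε (n + 1)) := by ring
      _ ≤ _ := by gcongr
  rw [← tendsto_add_atTop_iff_nat 1]
  have hlim : Tendsto (fun n => ‖x (n + 1 + 1) - x (n + 1)‖ / √(ε (n + 1 + 1))
      + ‖y (n + 1) - x (n + 1)‖ / √(ε (n + 1)) * √(ε (n + 1) / ε (n + 1 + 1))) atTop (𝓝 0) := by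
    simpa using (hvel.comp (tendsto_add_atTop_nat 1)).add
      (hyx.mul (hratio.comp (tendsto_add_atTop_nat 1)).sqrt)
  refine squeeze_zero' (Eventually.of_forall fun n => by positivity) ?_ hlim
  filter_upwards with n
  have he1 := Real.sqrt_pos.2 (hε (n + 1) (by omega))
  have he2 := Real.sqrt_pos.2 (hε (n + 1 + 1) (by omega))
  have h1 : ‖y (n + 1) - x (n + 1)‖ / √(ε (n + 1)) * √(ε (n + 1) / ε (n + 1 + 1)) =
      ‖y (n + 1) - x (n + 1)‖ / √(ε (n + 1 + 1)) := by
    rw [Real.sqrt_div (hε (n + 1) (by omega)).le]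
    field_simp
  rw [h1, ← add_div]
  gcongr
  have h2 : x (n + 1 + 1) - y (n + 1) = (x (n + 1 + 1) - x (n + 1)) - (y (n + 1) - x (n + 1)) := by
    abel
  rw [h2]
  exact norm_sub_le _ _

end Hilbert

theorem tireprog_p_fast_rates
    {H : Type*} [NormedAddCommGroup H] [InnerProductSpace ℝ H] [CompleteSpace H]
    (f : H → EReal) (g : H → ℝ) (g' : H → H) (L : ℝ) (hL : 0 < L)
    -- f is proper, convex and lower semicontinuous
    (hf_proper : ∃ z, f z ≠ ⊤) (hf_nebot : ∀ z, f z ≠ ⊥)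
    (hf_convex : ∀ u v : H, ∀ a b : ℝ, 0 ≤ a → 0 ≤ b → a + b = 1 →
      f (a • u + b • v) ≤ (a : EReal) * f u + (b : EReal) * f v)
    (hf_lsc : LowerSemicontinuous f)
    -- g is convex, differentiable with L-Lipschitz gradient g'
    (hg_convex : ConvexOn ℝ Set.univ g)
    (hg_diff : ∀ u : H, HasGradientAt g (g' u) u)
    (hg_lip : ∀ u v : H, ‖g' u - g' v‖ ≤ L * ‖u - v‖)
    -- prox_{σ f} is a minimizer of u ↦ f(u) + ‖u − z‖²/(2σ)
    (prox : ℝ → H → H)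
    (hprox : ∀ σ : ℝ, 0 < σ → ∀ z u : H,
      f (prox σ z) + ((‖prox σ z - z‖ ^ 2 / (2 * σ) : ℝ) : EReal)
        ≤ f u + ((‖u - z‖ ^ 2 / (2 * σ) : ℝ) : EReal))
    -- the parameters q, a, c, p with t_k = (ak+1)^q and ε_k = c/k^p
    (q a c p : ℝ) (hq1 : 1 / 2 ≤ q) (hq2 : q < 1)
    (ha1 : 0 < a) (ha2 : a ≤ 1 / (2 * q)) (hc : 0 < c) (hp1 : 0 < p) (hp2 : p < 2 * q)
    (t : ℕ → ℝ) (ht : ∀ k : ℕ, t k = (a * k + 1) ^ q)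
    (ε : ℕ → ℝ) (hε : ∀ k : ℕ, 1 ≤ k → ε k = c / (k : ℝ) ^ p)
    -- the stepsize
    (s : ℝ) (hs_pos : 0 < s) (hs_lt : s < 1 / L)
    -- the algorithm (TIREPROG)
    (x y : ℕ → H)
    (hy : ∀ k : ℕ, 1 ≤ k → y k = x k
        + (((t k - 1) * (t (k - 1) - 1)) / (t (k - 1)) ^ 2) • (x k - x (k - 1))
        - (((-(t k) ^ 2 + t k + (t (k - 1)) ^ 2) / ((t (k - 1)) ^ 2 * t k))) • x k)
    (hx : ∀ k : ℕ, 1 ≤ k →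
      x (k + 1) = prox s (y k - s • g' (y k) - (s * ε k) • y k))
    -- F_k(x) = f(x) + g(x) + (ε_k/2)‖x‖² and its unique minimizer x̄_k
    (F : ℕ → H → EReal)
    (hF : ∀ (k : ℕ) (u : H), F k u = f u + (g u : EReal) + ((ε k / 2 * ‖u‖ ^ 2 : ℝ) : EReal))
    (xbar : ℕ → H)
    (hxbar : ∀ (k : ℕ) (u : H), F k (xbar k) ≤ F k u)
    -- a (global) minimizer of f + g, so that (f+g)(xmin) = min (f+g)
    (xmin : H)
    (hxmin : ∀ u : H, f xmin + (g xmin : EReal) ≤ f u + (g u : EReal))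
 :
    Tendsto (fun k : ℕ => (((k : ℝ) ^ p : ℝ) : EReal) * (F k (x k) - F k (xbar k)))
      atTop (nhds (0 : EReal)) ∧
    (∃ C : ℝ, 0 < C ∧ ∃ K : ℕ, ∀ k : ℕ, K ≤ k →
      f (x k) + (g (x k) : EReal)
        ≤ f xmin + (g xmin : EReal) + ((C / (k : ℝ) ^ p : ℝ) : EReal)) ∧
    Tendsto (fun k : ℕ => (k : ℝ) ^ (p / 2) * ‖x k - x (k - 1)‖) atTop (nhds (0 : ℝ)) ∧
    ∃ u : ℕ → H,
      (∀ k : ℕ, 2 ≤ k → ∀ w : H,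
        f (x k) + ((⟪u k - g' (x k), w - x k⟫ : ℝ) : EReal) ≤ f w) ∧
      Tendsto (fun k : ℕ => (k : ℝ) ^ (p / 2) * ‖u k‖) atTop (nhds (0 : ℝ)) := by
  set D : Set H := {u | f u ≠ ⊤} with hD
  set φ : H → ℝ := fun u => (f u).toReal with hφdef
  have hcoe : ∀ u ∈ D, f u = (φ u : EReal) := fun u hu =>
    (EReal.coe_toReal hu (hf_nebot u)).symm
  have hφ : ConvexOn ℝ D φ := by
    have hle : ∀ u ∈ D, ∀ v ∈ D, ∀ a b : ℝ, 0 ≤ a → 0 ≤ b → a + b = 1 →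
        f (a • u + b • v) ≤ ((a * φ u + b * φ v : ℝ) : EReal) := by
      intro u hu v hv a b ha hb hab
      have := hf_convex u v a b ha hb hab
      rw [hcoe u hu, hcoe v hv] at this
      exact_mod_cast this
    have hmem : Convex ℝ D := fun u hu v hv a b ha hb hab =>
      ((hle u hu v hv a b ha hb hab).trans_lt (EReal.coe_lt_top _)).ne
    refine ⟨hmem, fun u hu v hv a b ha hb hab => ?_⟩
    have := hle u hu v hv a b ha hb hab
    rw [hcoe _ (hmem hu hv ha hb hab)] at this
    exact_mod_cast this
  set ψ : H → ℝ := fun u => φ u + g u with hψdef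
  have hψ : ConvexOn ℝ D ψ := hφ.add (hg_convex.subset (Set.subset_univ _) hφ.1)
  obtain ⟨z₀, hz₀⟩ := hf_proper
  have hz₀D : z₀ ∈ D := hz₀
  have hmem_of_le : ∀ (u v : H) (r r' : ℝ), v ∈ D → f u + (r : EReal) ≤ f v + (r' : EReal) →
      u ∈ D := by
    intro u v r r' hv h hu
    rw [hu, EReal.top_add_coe, hcoe v hv, ← EReal.coe_add, top_le_iff] at h
    exact EReal.coe_ne_top _ h
  have hFcoe : ∀ k, ∀ u ∈ D, F k u = (tikhonov ψ (ε k) u : EReal) := fun k u hu => by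
    rw [hF, hcoe u hu]; simp only [tikhonov, hψdef, EReal.coe_add]
  have hxminD : xmin ∈ D := hmem_of_le _ _ _ _ hz₀D (hxmin z₀)
  have hψmin : ∀ u ∈ D, ψ xmin ≤ ψ u := fun u hu => by
    have := hxmin u
    rw [hcoe u hu, hcoe _ hxminD] at this
    exact_mod_cast this
  have hxbarD : ∀ k, xbar k ∈ D := fun k => by
    have := hxbar k z₀
    rw [hF, hF, add_assoc, add_assoc, ← EReal.coe_add, ← EReal.coe_add] at this
    exact hmem_of_le _ _ _ _ hz₀D this
  have hbarmin : ∀ k, ∀ u ∈ D, tikhonov ψ (ε k) (xbar k) ≤ tikhonov ψ (ε k) u := fun k u hu => by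
    have := hxbar k u
    rw [hFcoe k _ (hxbarD k), hFcoe k u hu] at this
    exact_mod_cast this
  have hεpos : ∀ n, 1 ≤ n → 0 < ε n := fun n hn => by
    have : (0 : ℝ) < n := by exact_mod_cast hn
    rw [hε n hn]; positivity
  have hεstrict : ∀ n, 1 ≤ n → ε (n + 1) < ε n := fun n hn => by
    have h1 : (0 : ℝ) < n := by exact_mod_cast hn
    rw [hε n hn, hε (n + 1) (by omega)]
    apply div_lt_div_of_pos_left hc (by positivity)
    apply Real.rpow_lt_rpow h1.le _ hp1
    push_cast; linarith
  have hεlim : Tendsto ε atTop (𝓝 0) := by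
    have h1 : Tendsto (fun n : ℕ => c / (n : ℝ) ^ p) atTop (𝓝 0) :=
      ((tendsto_rpow_atTop hp1).comp tendsto_natCast_atTop_atTop).const_div_atTop c
    refine h1.congr' ?_
    filter_upwards [eventually_ge_atTop 1] with n hn
    rw [hε n hn]
  -- the minimizers of the regularized problems converge to a solution
  obtain ⟨w, hw⟩ := exists_tendsto_tikhonov_minimizer hψ (e := fun n => ε (n + 1))
    (m := fun n => xbar (n + 1)) (fun n => hεpos _ (by omega))
    (strictAnti_nat_of_succ_lt fun n => hεstrict _ (by omega)) (fun n => hxbarD _)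
    (fun n => hbarmin _) hxminD hψmin
  have hbarlim : Tendsto xbar atTop (𝓝 w) := (tendsto_add_atTop_iff_nat 1).1 hw
  have hgcont : Continuous g := continuous_iff_continuousAt.2 fun u =>
    (hg_diff u).hasFDerivAt.continuousAt
  have hfw : f w ≤ ((ψ xmin - g w : ℝ) : EReal) := by
    by_contra hcon
    rw [not_le] at hcon
    obtain ⟨b, hb1, hb2⟩ := EReal.lt_iff_exists_real_btwn.1 hcon
    have hb1' : ψ xmin - g w < b := by exact_mod_cast hb1
    have h1 : ∀ᶠ n in atTop, (b : EReal) < f (xbar n) := hbarlim.eventually (hf_lsc w b hb2)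
    have h2 : Tendsto (fun n => ψ xmin + ε n / 2 * ‖xmin‖ ^ 2 - g (xbar n)) atTop
        (𝓝 (ψ xmin - g w)) := by
      simpa using (((hεlim.div_const 2).mul_const (‖xmin‖ ^ 2)).const_add (ψ xmin)).sub
        ((hgcont.tendsto w).comp hbarlim)
    obtain ⟨n, hn1, hn2, hn3⟩ :=
      (h1.and ((h2.eventually_lt_const hb1').and (eventually_ge_atTop 1))).exists
    rw [hcoe _ (hxbarD n)] at hn1
    have hn1' : b < φ (xbar n) := by exact_mod_cast hn1
    have h3 := hbarmin n xmin hxminD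
    have h4 : 0 ≤ ε n / 2 * ‖xbar n‖ ^ 2 := mul_nonneg (by linarith [hεpos n hn3]) (sq_nonneg _)
    simp only [tikhonov, hψdef] at h3 hn2
    linarith
  have hwD : w ∈ D := (hfw.trans_lt (EReal.coe_lt_top _)).ne
  have hwmin : ∀ u ∈ D, ψ w ≤ ψ u := fun u hu => by
    rw [hcoe w hwD] at hfw
    have h1 : φ w ≤ ψ xmin - g w := by exact_mod_cast hfw
    have h2 := hψmin u hu
    simp only [hψdef] at h1 h2 ⊢
    linarith
  -- the iterates satisfy the prox inequality
  have hproxD : ∀ σ, 0 < σ → ∀ v, prox σ v ∈ D := fun σ hσ v =>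
    hmem_of_le _ _ _ _ hz₀D (hprox σ hσ v z₀)
  have hxD : ∀ n, 1 ≤ n → x (n + 1) ∈ D := fun n hn => by
    rw [hx n hn]; exact hproxD s hs_pos _
  have hsub : ∀ n, 1 ≤ n → ∀ v ∈ D, φ (x (n + 1)) +
      ⟪s⁻¹ • (y n - s • g' (y n) - (s * ε n) • y n - x (n + 1)), v - x (n + 1)⟫ ≤ φ v := by
    intro n hn v hv
    refine add_inner_le_of_prox hφ hs_pos (hxD n hn) (fun u hu => ?_) hv
    have := hprox s hs_pos (y n - s • g' (y n) - (s * ε n) • y n) u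
    rw [← hx n hn, hcoe u hu, hcoe _ (hxD n hn)] at this
    exact_mod_cast this
  have hsL : s * L < 1 := by rwa [lt_div_iff₀ hL] at hs_lt
  have hstep : ∀ᶠ n in atTop, ∀ u ∈ D,
      2 * s * (tikhonov ψ (ε n) (x (n + 1)) - tikhonov ψ (ε n) u) ≤
        ‖y n - u‖ ^ 2 - ‖x (n + 1) - u‖ ^ 2 := by
    have h1 : Tendsto (fun n => s * (L + ε n)) atTop (𝓝 (s * L)) := by
      simpa using (hεlim.const_add L).const_mul s
    filter_upwards [h1.eventually_lt_const hsL, eventually_ge_atTop 1] with n hn h1 u hu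
    exact tikhonov_prox_grad_step hg_convex hg_diff hg_lip hs_pos (hεpos n h1).le hn.le
      (hsub n h1) hu
  have hq0 : 0 ≤ q := by linarith
  have ht1 : ∀ n, 1 ≤ t n := fun n => by
    rw [ht]
    apply Real.one_le_rpow _ hq0
    have : 0 ≤ a * (n : ℝ) := by positivity
    linarith
  have htmono : ∀ n, t n ≤ t (n + 1) := fun n => by
    rw [ht, ht]
    apply Real.rpow_le_rpow (by positivity) _ hq0
    push_cast
    linarith
  have hη : Tendsto (fun n => t (n + 1) * (ε n / ε (n + 1) - 1)) atTop (𝓝 0) := by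
    refine (tendsto_rpow_mul_ratio_sub_one hq0 hq2 ha1 hc hp1 (by linarith)).congr' ?_
    filter_upwards [eventually_ge_atTop 1] with n hn
    rw [ht, hε n hn, hε (n + 1) (by omega)]
  have hinv : Tendsto (fun n => 1 / (t n ^ 2 * ε (n + 1))) atTop (𝓝 0) := by
    refine (tendsto_one_div_sq_rpow_mul hq0 ha1 hc hp2).congr fun n => ?_
    rw [ht, hε (n + 1) (by omega)]
  have hsum : ¬ Summable (fun n => 1 / t n) := by
    simpa only [ht] using not_summable_one_div_rpow hq2.le ha1
  have hy' : ∀ n, y (n + 1) = x (n + 1) - (1 / t (n + 1)) • x (n + 1)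
      + ((t (n + 1) ^ 2 - t (n + 1)) / t n ^ 2 / t (n + 1)) •
        (t n • x (n + 1) - (t n - 1) • x n) := fun n => by
    rw [hy (n + 1) (by omega), Nat.add_sub_cancel]
    have h1 : t n ≠ 0 := by linarith [ht1 n]
    have h2 : t (n + 1) ≠ 0 := by linarith [ht1 (n + 1)]
    match_scalars
    all_goals field_simp
    all_goals ring
  obtain ⟨hgap, hxlim, hvel, hres, hratio⟩ := tikhonov_inertial_rates hψ hs_pos ht1 htmono
    (fun n => by rw [ht, ht]; exact sq_rpow_sub_le hq1 hq2 ha1 ha2 n) hεpos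
    (fun n hn => (hεstrict n hn).le) hη hinv hsum hwD hwmin (fun n _ => hxbarD n)
    (fun n _ => hbarmin n) hbarlim hxD hy' hstep
  have hkp : ∀ n : ℕ, 1 ≤ n → (n : ℝ) ^ p = c / ε n := fun n hn => by
    have : (0 : ℝ) < n := by exact_mod_cast hn
    rw [hε n hn]; field_simp
  have hkp2 : ∀ n : ℕ, 1 ≤ n → (n : ℝ) ^ (p / 2) = √c / √(ε n) := fun n hn => by
    rw [← Real.sqrt_div hc.le, ← hkp n hn, Real.sqrt_eq_rpow, ← Real.rpow_mul n.cast_nonneg]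
    congr 1; ring
  have hgapk : Tendsto (fun k : ℕ => (k : ℝ) ^ p *
      (tikhonov ψ (ε k) (x k) - tikhonov ψ (ε k) (xbar k))) atTop (𝓝 0) := by
    have h1 := hgap.const_mul c
    rw [mul_zero] at h1
    refine h1.congr' ?_
    filter_upwards [eventually_ge_atTop 1] with n hn
    rw [hkp n hn]; ring
  have hxD' : ∀ n, 2 ≤ n → x n ∈ D := fun n hn => by
    obtain ⟨k, rfl⟩ : ∃ k, n = k + 1 := ⟨n - 1, by omega⟩
    exact hxD k (by omega)
  refine ⟨?_, ?_, ?_, ?_⟩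
  · have h1 := EReal.tendsto_coe.2 hgapk
    rw [EReal.coe_zero] at h1
    refine h1.congr' ?_
    filter_upwards [eventually_ge_atTop 2] with n hn
    rw [hFcoe n _ (hxD' n hn), hFcoe n _ (hxbarD n), EReal.coe_mul, EReal.coe_sub]
  · obtain ⟨K, hK⟩ := eventually_atTop.1 (hgapk.eventually_lt_const one_pos)
    refine ⟨1 + c / 2 * ‖xmin‖ ^ 2, by positivity, max K 2, fun k hk => ?_⟩
    have hk2 : 2 ≤ k := le_of_max_le_right hk
    have hk0 : (0 : ℝ) < k := by exact_mod_cast (show 0 < k by omega)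
    have hkp0 : 0 < (k : ℝ) ^ p := by positivity
    rw [hcoe _ (hxD' k hk2), hcoe _ hxminD]
    norm_cast
    have h1 := hK k (le_of_max_le_left hk)
    have h2 := hbarmin k xmin hxminD
    have h3 : tikhonov ψ (ε k) (x k) - tikhonov ψ (ε k) (xbar k) < 1 / (k : ℝ) ^ p := by
      rw [lt_div_iff₀ hkp0]; linarith
    have h4 : (1 + c / 2 * ‖xmin‖ ^ 2) / (k : ℝ) ^ p =
        1 / (k : ℝ) ^ p + ε k / 2 * ‖xmin‖ ^ 2 := by
      rw [hε k (by omega)]; field_simp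
    have h5 : 0 ≤ ε k / 2 * ‖x k‖ ^ 2 :=
      mul_nonneg (by linarith [hεpos k (by omega)]) (sq_nonneg _)
    rw [h4]
    simp only [tikhonov, hψdef] at h2 h3
    linarith
  · rw [← tendsto_add_atTop_iff_nat 1]
    have h1 := hvel.const_mul √c
    rw [mul_zero] at h1
    refine h1.congr fun n => ?_
    rw [hkp2 (n + 1) (by omega), Nat.add_sub_cancel]; ring
  · refine ⟨fun k => s⁻¹ • (y (k - 1) - s • g' (y (k - 1)) - (s * ε (k - 1)) • y (k - 1) - x k)
      + g' (x k), fun k hk v => ?_, ?_⟩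
    · obtain ⟨n, rfl⟩ : ∃ n, k = n + 1 := ⟨k - 1, by omega⟩
      by_cases hv : v ∈ D
      · rw [hcoe v hv, hcoe _ (hxD' _ hk), add_sub_cancel_right, Nat.add_sub_cancel]
        exact_mod_cast hsub n (by omega) v hv
      · have : f v = ⊤ := not_not.1 hv
        rw [this]; exact le_top
    · rw [← tendsto_add_atTop_iff_nat 1]
      have hsqrt : Tendsto (fun n => √(ε (n + 1))) atTop (𝓝 0) := by
        simpa using (hεlim.comp (tendsto_add_atTop_nat 1)).sqrt
      have hlim : Tendsto (fun n => √c * ((s⁻¹ + L) * (‖x (n + 1) - y n‖ / √(ε (n + 1)))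
          + ε n / ε (n + 1) * √(ε (n + 1)) *
            (‖x (n + 1)‖ + ‖x (n + 1) - y n‖ / √(ε (n + 1)) * √(ε (n + 1))))) atTop (𝓝 0) := by
        have h1 := (hxlim.comp (tendsto_add_atTop_nat 1)).norm
        simpa using (((hres.const_mul (s⁻¹ + L)).add ((hratio.mul hsqrt).mul
          (h1.add (hres.mul hsqrt)))).const_mul √c)
      refine squeeze_zero' (Eventually.of_forall fun n => by positivity) ?_ hlim
      filter_upwards [eventually_ge_atTop 1] with n hn
      have he1 := hεpos (n + 1) (by omega)
      have he0 := hεpos n hn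
      have hr := Real.sqrt_pos.2 he1
      have hr2 := Real.sq_sqrt he1.le
      rw [hkp2 (n + 1) (by omega), Nat.add_sub_cancel]
      have h1 : s⁻¹ • (y n - s • g' (y n) - (s * ε n) • y n - x (n + 1)) + g' (x (n + 1)) =
          (g' (x (n + 1)) - g' (y n)) - s⁻¹ • (x (n + 1) - y n) - ε n • y n := by
        match_scalars
        all_goals field_simp
      have h2 : ‖y n‖ ≤ ‖x (n + 1)‖ + ‖x (n + 1) - y n‖ := by
        have h3 : y n = x (n + 1) - (x (n + 1) - y n) := by abel
        calc ‖y n‖ = ‖x (n + 1) - (x (n + 1) - y n)‖ := by rw [← h3]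
          _ ≤ _ := norm_sub_le _ _
      have h4 : ‖s⁻¹ • (y n - s • g' (y n) - (s * ε n) • y n - x (n + 1)) + g' (x (n + 1))‖ ≤
          (s⁻¹ + L) * ‖x (n + 1) - y n‖ + ε n * (‖x (n + 1)‖ + ‖x (n + 1) - y n‖) := by
        rw [h1]
        calc _ ≤ ‖g' (x (n + 1)) - g' (y n)‖ + ‖s⁻¹ • (x (n + 1) - y n)‖ + ‖ε n • y n‖ :=
              (norm_sub_le _ _).trans (by gcongr; exact norm_sub_le _ _)
          _ ≤ L * ‖x (n + 1) - y n‖ + s⁻¹ * ‖x (n + 1) - y n‖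
              + ε n * (‖x (n + 1)‖ + ‖x (n + 1) - y n‖) := by
              rw [norm_smul, norm_smul, Real.norm_of_nonneg (inv_pos.2 hs_pos).le,
                Real.norm_of_nonneg he0.le]
              gcongr
              exact hg_lip _ _
          _ = _ := by ring
      calc _ ≤ √c / √(ε (n + 1)) * ((s⁻¹ + L) * ‖x (n + 1) - y n‖
              + ε n * (‖x (n + 1)‖ + ‖x (n + 1) - y n‖)) := by gcongr
        _ = _ := by
          rw [div_mul_cancel₀ _ hr.ne']
          have h5 : ε n / ε (n + 1) * √(ε (n + 1)) = ε n / √(ε (n + 1)) := by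
            rw [div_mul_eq_mul_div, div_eq_div_iff he1.ne' hr.ne', mul_assoc, ← sq, hr2]
          rw [h5]
          field_simp
end

section
/- Let 1/2 ≤ q ≤ 1, 0 < a ≤ 1/(2q), c > 0 and p ≥ 2q, and additionally assume p > 2 in the case q = 1, a = 1/2. Set t_k = (ak+1)^q for k ≥ 0 and ε_k = c/k^p for k ≥ 1, let 0 < s < 1/L, and let (x_k) be generated by (TIREPROG) with these parameters. Then there exist C > 0 and K ∈ ℕ such that (f+g)(x_k) − min(f+g) ≤ C k^{−2q} for all k ≥ K. -/
open Filter Topology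
open scoped RealInnerProductSpace

section ConvexSmooth

variable {H : Type*} [NormedAddCommGroup H] [InnerProductSpace ℝ H]

theorem HasGradientAt.hasDerivAt_line [CompleteSpace H] {g : H → ℝ} {v u d : H} {r : ℝ}
    (h : HasGradientAt g v (u + r • d)) :
    HasDerivAt (fun τ : ℝ => g (u + τ • d)) ⟪v, d⟫ r := by
  have hline : HasDerivAt (fun τ : ℝ => u + τ • d) d r := by
    simpa using ((hasDerivAt_id r).smul_const d).const_add u
  have := h.hasFDerivAt.comp_hasDerivAt r hline
  rwa [InnerProductSpace.toDual_apply_apply] at this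

theorem ConvexOn.add_inner_gradient_le [CompleteSpace H] {g : H → ℝ} {v u : H}
    (hg : ConvexOn ℝ Set.univ g) (h : HasGradientAt g v u) (w : H) :
    g u + ⟪v, w - u⟫ ≤ g w := by
  have hconv : ConvexOn ℝ Set.univ (fun τ : ℝ => g (u + τ • (w - u))) := by
    have := hg.comp_affineMap (AffineMap.lineMap u w : ℝ →ᵃ[ℝ] H)
    simpa [Function.comp_def, AffineMap.lineMap_apply, add_comm] using this
  have hder := HasGradientAt.hasDerivAt_line (g := g) (v := v) (u := u) (d := w - u) (r := 0)
    (by simpa using h)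
  have := hconv.le_slope_of_hasDerivAt (Set.mem_univ 0) (Set.mem_univ 1) one_pos hder
  simp [slope_def_field] at this
  linarith

/-- The descent lemma for a function with Lipschitz gradient. -/
theorem le_add_inner_gradient_add_of_lipschitz [CompleteSpace H] {g : H → ℝ} {g' : H → H} {L : ℝ}
    (hg : ∀ u, HasGradientAt g (g' u) u) (hlip : ∀ u v, ‖g' u - g' v‖ ≤ L * ‖u - v‖) (u w : H) :
    g w ≤ g u + ⟪g' u, w - u⟫ + L / 2 * ‖w - u‖ ^ 2 := by
  set d := w - u with hd
  have hder : ∀ r : ℝ, HasDerivAt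
      (fun τ : ℝ => g (u + τ • d) - τ * ⟪g' u, d⟫ - L / 2 * ‖d‖ ^ 2 * τ ^ 2)
      (⟪g' (u + r • d), d⟫ - 1 * ⟪g' u, d⟫ - L / 2 * ‖d‖ ^ 2 * (2 * r)) r := by
    intro r
    refine ((HasGradientAt.hasDerivAt_line (hg _)).sub
      ((hasDerivAt_id r).mul_const _)).sub ?_
    simpa using (hasDerivAt_pow 2 r).const_mul (L / 2 * ‖d‖ ^ 2)
  have hanti : AntitoneOn
      (fun τ : ℝ => g (u + τ • d) - τ * ⟪g' u, d⟫ - L / 2 * ‖d‖ ^ 2 * τ ^ 2) (Set.Icc 0 1) := by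
    refine antitoneOn_of_deriv_nonpos (convex_Icc 0 1)
      (fun r _ => (hder r).continuousAt.continuousWithinAt)
      (fun r _ => (hder r).differentiableAt.differentiableWithinAt) fun r hr => ?_
    rw [interior_Icc] at hr
    rw [(hder r).deriv]
    have hcs : ⟪g' (u + r • d) - g' u, d⟫ ≤ L * (r * ‖d‖) * ‖d‖ := by
      refine (real_inner_le_norm _ _).trans (mul_le_mul_of_nonneg_right ?_ (norm_nonneg d))
      refine (hlip _ _).trans_eq ?_
      rw [add_sub_cancel_left, norm_smul, Real.norm_of_nonneg hr.1.le]
    rw [inner_sub_left] at hcs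
    linarith
  have := hanti (Set.left_mem_Icc.2 zero_le_one) (Set.right_mem_Icc.2 zero_le_one) zero_le_one
  simp only [one_smul, zero_smul, add_zero, hd, add_sub_cancel] at this
  linarith

/-- The three-point inequality for a minimizer `w` of `u ↦ f u + ‖u - v‖² / (2 s)`. -/
theorem toReal_add_three_point_le_of_prox {f : H → EReal} (hbot : ∀ z, f z ≠ ⊥)
    (hconv : ∀ u v : H, ∀ a b : ℝ, 0 ≤ a → 0 ≤ b → a + b = 1 →
      f (a • u + b • v) ≤ (a : EReal) * f u + (b : EReal) * f v)
    {s : ℝ} {v w : H}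
    (hw : ∀ u, f w + ((‖w - v‖ ^ 2 / (2 * s) : ℝ) : EReal)
      ≤ f u + ((‖u - v‖ ^ 2 / (2 * s) : ℝ) : EReal))
    (hwtop : f w ≠ ⊤) {z : H} (hz : f z ≠ ⊤) :
    (f w).toReal + (‖w - v‖ ^ 2 + ‖z - w‖ ^ 2) / (2 * s)
      ≤ (f z).toReal + ‖z - v‖ ^ 2 / (2 * s) := by
  have key : ∀ r : ℝ, 0 < r → r ≤ 1 →
      (f w).toReal + (‖w - v‖ ^ 2 + (1 - r) * ‖z - w‖ ^ 2) / (2 * s)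
        ≤ (f z).toReal + ‖z - v‖ ^ 2 / (2 * s) := by
    intro r hr0 hr1
    have h1 := (hw ((1 - r) • w + r • z)).trans
      (add_le_add_left (hconv w z (1 - r) r (by linarith) hr0.le (by ring)) _)
    rw [← EReal.coe_toReal hwtop (hbot w), ← EReal.coe_toReal hz (hbot z)] at h1
    norm_cast at h1
    have h2 : ‖(1 - r) • w + r • z - v‖ ^ 2
        = (1 - r) * ‖w - v‖ ^ 2 + r * ‖z - v‖ ^ 2 - r * (1 - r) * ‖z - w‖ ^ 2 := by
      simp only [← real_inner_self_eq_norm_sq, inner_sub_left, inner_sub_right, inner_add_left,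
        inner_add_right, inner_smul_left, inner_smul_right, RCLike.conj_to_real,
        real_inner_comm w z, real_inner_comm w v, real_inner_comm z v]
      ring
    rw [h2] at h1
    refine le_of_mul_le_mul_left ?_ hr0
    ring_nf at h1 ⊢
    linarith
  refine le_of_tendsto (x := 𝓝[>] (0 : ℝ)) (f := fun r : ℝ =>
    (f w).toReal + (‖w - v‖ ^ 2 + (1 - r) * ‖z - w‖ ^ 2) / (2 * s)) ?_ ?_
  · refine Tendsto.mono_left ?_ nhdsWithin_le_nhds
    have : Continuous fun r : ℝ =>
      (f w).toReal + (‖w - v‖ ^ 2 + (1 - r) * ‖z - w‖ ^ 2) / (2 * s) := by fun_prop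
    simpa using this.tendsto 0
  · filter_upwards [Ioc_mem_nhdsGT (zero_lt_one' ℝ)] with r hr using key r hr.1 hr.2

/-- The basic inequality of a proximal-gradient step for `f + g + (ε / 2) ‖·‖²`. -/
theorem toReal_regularized_prox_grad_step_le [CompleteSpace H] {f : H → EReal}
    (hbot : ∀ z, f z ≠ ⊥)
    (hconv : ∀ u v : H, ∀ a b : ℝ, 0 ≤ a → 0 ≤ b → a + b = 1 →
      f (a • u + b • v) ≤ (a : EReal) * f u + (b : EReal) * f v)
    {g : H → ℝ} {g' : H → H} {L : ℝ} (hgc : ConvexOn ℝ Set.univ g)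
    (hg : ∀ u, HasGradientAt g (g' u) u) (hlip : ∀ u v, ‖g' u - g' v‖ ≤ L * ‖u - v‖)
    {s ε : ℝ} (hs : 0 < s) (hε : 0 ≤ ε) (hsL : s * (L + ε) ≤ 1) {y w : H}
    (hw : ∀ u, f w + ((‖w - (y - s • g' y - (s * ε) • y)‖ ^ 2 / (2 * s) : ℝ) : EReal)
      ≤ f u + ((‖u - (y - s • g' y - (s * ε) • y)‖ ^ 2 / (2 * s) : ℝ) : EReal))
    (hwtop : f w ≠ ⊤) {z : H} (hz : f z ≠ ⊤) :
    (f w).toReal + g w + ε / 2 * ‖w‖ ^ 2 + ‖z - w‖ ^ 2 / (2 * s)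
      ≤ (f z).toReal + g z + ε / 2 * ‖z‖ ^ 2 + ‖z - y‖ ^ 2 / (2 * s) := by
  have h1 := toReal_add_three_point_le_of_prox hbot hconv hw hwtop hz
  have h2 := le_add_inner_gradient_add_of_lipschitz hg hlip y w
  have h3 := hgc.add_inner_gradient_le (hg y) z
  have expand : ∀ u : H, ‖u - (y - s • g' y - (s * ε) • y)‖ ^ 2 / (2 * s)
      = ‖u - y‖ ^ 2 / (2 * s) + ⟪g' y, u - y⟫ + ε * ⟪y, u - y⟫ + s / 2 * ‖g' y + ε • y‖ ^ 2 := by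
    intro u
    have : u - (y - s • g' y - (s * ε) • y) = (u - y) + s • (g' y + ε • y) := by module
    rw [this, norm_add_sq_real, norm_smul, Real.norm_of_nonneg hs.le, real_inner_smul_right,
      inner_add_right, real_inner_smul_right, real_inner_comm (g' y), real_inner_comm y]
    field_simp
    ring
  have sq : ∀ u : H, ‖u‖ ^ 2 = ‖y‖ ^ 2 + 2 * ⟪y, u - y⟫ + ‖u - y‖ ^ 2 := by
    intro u
    rw [← norm_add_sq_real, add_sub_cancel]
  rw [add_div, expand, expand] at h1
  rw [sq w, sq z]
  have h4 : (L + ε) / 2 * ‖w - y‖ ^ 2 ≤ ‖w - y‖ ^ 2 / (2 * s) := by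
    rw [le_div_iff₀ (by positivity)]
    nlinarith [mul_le_mul_of_nonneg_right hsL (sq_nonneg ‖w - y‖)]
  nlinarith [mul_nonneg hε (sq_nonneg ‖z - y‖)]

theorem weighted_sq_dist_sub_identity (t : ℝ) (b y w z : H) :
    t * ((t - 1) * (‖b - y‖ ^ 2 - ‖b - w‖ ^ 2) + (‖z - y‖ ^ 2 - ‖z - w‖ ^ 2))
      = ‖t • y - (t - 1) • b - z‖ ^ 2 - ‖t • w - (t - 1) • b - z‖ ^ 2 := by
  simp only [← real_inner_self_eq_norm_sq, inner_sub_left, inner_sub_right,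
    inner_smul_left, inner_smul_right, RCLike.conj_to_real,
    real_inner_comm b y, real_inner_comm b w, real_inner_comm z y, real_inner_comm z w,
    real_inner_comm z b]
  ring

theorem norm_smul_sub_sq_le {θ : ℝ} (h0 : 0 ≤ θ) (h1 : θ ≤ 1) (u z : H) :
    ‖θ • u - z‖ ^ 2 ≤ θ * ‖u - z‖ ^ 2 + (1 - θ) * ‖z‖ ^ 2 := by
  have key : θ * ‖u - z‖ ^ 2 + (1 - θ) * ‖z‖ ^ 2 - ‖θ • u - z‖ ^ 2
      = θ * (1 - θ) * ‖u‖ ^ 2 := by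
    simp only [← real_inner_self_eq_norm_sq, inner_sub_left, inner_sub_right,
      inner_smul_left, inner_smul_right, RCLike.conj_to_real, real_inner_comm z u]
    ring
  nlinarith [mul_nonneg (mul_nonneg h0 (sub_nonneg.2 h1)) (sq_nonneg ‖u‖)]

/-- One step of the energy estimate for an inertial method whose extrapolated point `y` satisfies
`t • y - (t - 1) • b = θ • u`. -/
theorem inertial_energy_step {Fw Fb Fz ε ε' s t r θ : ℝ} {b y w z u : H} (hs : 0 < s)
    (ht : 1 ≤ t) (hθr : θ * r ^ 2 = t * (t - 1)) (hθ0 : 0 ≤ θ) (hθ1 : θ ≤ 1) (hε : ε ≤ ε')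
    (hu : t • y - (t - 1) • b = θ • u)
    (hb : Fw + ε / 2 * ‖w‖ ^ 2 + ‖b - w‖ ^ 2 / (2 * s)
      ≤ Fb + ε / 2 * ‖b‖ ^ 2 + ‖b - y‖ ^ 2 / (2 * s))
    (hz : Fw + ε / 2 * ‖w‖ ^ 2 + ‖z - w‖ ^ 2 / (2 * s)
      ≤ Fz + ε / 2 * ‖z‖ ^ 2 + ‖z - y‖ ^ 2 / (2 * s)) :
    t ^ 2 * (Fw + ε / 2 * ‖w‖ ^ 2 - Fz) + ‖t • w - (t - 1) • b - z‖ ^ 2 / (2 * s)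
      ≤ θ * (r ^ 2 * (Fb + ε' / 2 * ‖b‖ ^ 2 - Fz) + ‖u - z‖ ^ 2 / (2 * s))
        + ((1 - θ) * (‖z‖ ^ 2 / (2 * s)) + ‖z‖ ^ 2 / 2 * (t * ε)) := by
  have htt : 0 ≤ t * (t - 1) := mul_nonneg (by linarith) (by linarith)
  have hid := weighted_sq_dist_sub_identity t b y w z
  have hcontr := norm_smul_sub_sq_le hθ0 hθ1 u z
  rw [hu] at hid
  have hid' : ‖t • w - (t - 1) • b - z‖ ^ 2 / (2 * s)
      = ‖θ • u - z‖ ^ 2 / (2 * s) - t * (t - 1) * (‖b - y‖ ^ 2 / (2 * s) - ‖b - w‖ ^ 2 / (2 * s))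
        - t * (‖z - y‖ ^ 2 / (2 * s) - ‖z - w‖ ^ 2 / (2 * s)) := by
    have hsub : ‖t • w - (t - 1) • b - z‖ ^ 2 = ‖θ • u - z‖ ^ 2
        - t * ((t - 1) * (‖b - y‖ ^ 2 - ‖b - w‖ ^ 2) + (‖z - y‖ ^ 2 - ‖z - w‖ ^ 2)) := by
      linarith
    rw [hsub]
    ring
  have hcontr' : ‖θ • u - z‖ ^ 2 / (2 * s)
      ≤ θ * (‖u - z‖ ^ 2 / (2 * s)) + (1 - θ) * (‖z‖ ^ 2 / (2 * s)) := by
    refine (div_le_div_of_nonneg_right hcontr (by positivity)).trans_eq ?_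
    ring
  have hbw := mul_le_mul_of_nonneg_left hb htt
  have hzw := mul_le_mul_of_nonneg_left hz (by linarith : 0 ≤ t)
  have hmono : t * (t - 1) * (ε / 2 * ‖b‖ ^ 2) ≤ t * (t - 1) * (ε' / 2 * ‖b‖ ^ 2) := by gcongr
  rw [mul_add, ← mul_assoc θ, hθr, hid']
  linarith

end ConvexSmooth

theorem bddAbove_of_contraction_add_summable {E θ b : ℕ → ℝ} {M : ℝ} {K : ℕ}
    (h0 : ∀ k, K ≤ k → 0 ≤ θ k) (h1 : ∀ k, K ≤ k → θ k ≤ 1) (hb : ∀ k, 0 ≤ b k)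
    (hsum : Summable b)
    (hE : ∀ k, K ≤ k → E (k + 1) ≤ θ k * E k + (1 - θ k) * M + b k) :
    ∃ B, ∀ k, K ≤ k → E k ≤ B := by
  have key : ∀ k, K ≤ k → E k ≤ max (E K) M + ∑ i ∈ Finset.range k, b i := by
    intro k hk
    induction k, hk using Nat.le_induction with
    | base =>
      have := Finset.sum_nonneg fun i (_ : i ∈ Finset.range K) => hb i
      linarith [le_max_left (E K) M]
    | succ k hk ih =>
      rw [Finset.sum_range_succ]
      have hS := Finset.sum_nonneg fun i (_ : i ∈ Finset.range k) => hb i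
      have hM : M ≤ max (E K) M + ∑ i ∈ Finset.range k, b i := by
        linarith [le_max_right (E K) M]
      linarith [hE k hk, mul_le_mul_of_nonneg_left ih (h0 k hk),
        mul_le_mul_of_nonneg_left hM (sub_nonneg.2 (h1 k hk))]
  exact ⟨max (E K) M + ∑' i, b i, fun k hk =>
    (key k hk).trans (by linarith [hsum.sum_le_tsum (Finset.range k) fun i _ => hb i])⟩

/-- Growth of `τ ^ (2 q)` over a step of length `a`. -/
theorem rpow_sq_sub_rpow_sq_le {q a τ : ℝ} (hq1 : 1 / 2 ≤ q) (hτ : 0 < τ) (haτ : a ≤ τ) :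
    (τ ^ q) ^ 2 - ((τ - a) ^ q) ^ 2 ≤ 2 * q * a * τ ^ (q - 1) * τ ^ q := by
  have hb := one_add_mul_self_le_rpow_one_add (s := -(a / τ)) (p := 2 * q)
    (by have := (div_le_one hτ).2 haτ; linarith) (by linarith)
  have h0 : 0 ≤ 1 + -(a / τ) := by have := (div_le_one hτ).2 haτ; linarith
  have hsplit : (τ - a) ^ (2 * q) = τ ^ (2 * q) * (1 + -(a / τ)) ^ (2 * q) := by
    rw [← Real.mul_rpow hτ.le h0]
    congr 1
    field_simp
    ring
  have hpow : ∀ r : ℝ, 0 ≤ r → (r ^ q) ^ 2 = r ^ (2 * q) := fun r hr => by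
    rw [← Real.rpow_natCast, ← Real.rpow_mul hr, mul_comm]; norm_num
  rw [hpow τ hτ.le, hpow (τ - a) (by linarith), hsplit, mul_assoc _ (τ ^ (q - 1)),
    ← Real.rpow_add hτ]
  have h1 : τ ^ (q - 1 + q) = τ ^ (2 * q) / τ := by
    rw [← Real.rpow_sub_one hτ.ne']; ring_nf
  rw [h1]
  have hm := mul_le_mul_of_nonneg_left hb (Real.rpow_nonneg hτ.le (2 * q))
  have : τ ^ (2 * q) * (1 + 2 * q * -(a / τ)) = τ ^ (2 * q) - 2 * q * a * (τ ^ (2 * q) / τ) := by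
    ring
  linarith

/-- The sequence `t k = (a k + 1) ^ q` and the damping factors
`t k (t k - 1) / t (k - 1) ^ 2` absorb the perturbation `t k * c / k ^ p`. -/
theorem exists_absorbing_bound {q a c p : ℝ} (hq1 : 1 / 2 ≤ q) (hq2 : q ≤ 1) (ha1 : 0 < a)
    (ha2 : a ≤ 1 / (2 * q)) (hc : 0 < c) (hp : 2 * q ≤ p) (hspec : q = 1 → a = 1 / 2 → 2 < p)
    {t : ℕ → ℝ} (ht : ∀ k : ℕ, t k = (a * k + 1) ^ q) :
    (∀ k, 1 ≤ k → t k * (t k - 1) / t (k - 1) ^ 2 ≤ 1) ∧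
    ∃ (M : ℝ) (b : ℕ → ℝ), (∀ k, 0 ≤ b k) ∧ Summable b ∧ ∀ k : ℕ, 1 ≤ k →
      t k * (c / (k : ℝ) ^ p) ≤ (1 - t k * (t k - 1) / t (k - 1) ^ 2) * M + b k := by
  have hqa : 2 * q * a ≤ 1 := by
    rwa [le_div_iff₀ (by linarith), mul_comm] at ha2
  have hdec : ∀ r : ℝ, 1 ≤ r → r ^ (q - 1) ≤ 1 := fun r hr =>
    Real.rpow_le_one_of_one_le_of_nonpos hr (by linarith)
  have hτ : ∀ k : ℕ, 1 ≤ k → 1 + a ≤ a * k + 1 := fun k hk => by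
    have : (1 : ℝ) ≤ k := by exact_mod_cast hk
    nlinarith
  have htpos : ∀ k, 0 < t k := fun k => by rw [ht]; positivity
  have hmono : ∀ k, 1 ≤ k → t (k - 1) ≤ t k := fun k hk => by
    rw [ht, ht]
    have : ((k - 1 : ℕ) : ℝ) ≤ k := by exact_mod_cast Nat.sub_le k 1
    gcongr
  -- the defect `1 - t k (t k - 1) / t (k - 1) ^ 2` is at least `δ / t k`
  have hdefect : ∀ k, 1 ≤ k → t k * (1 - 2 * q * a * (1 + a) ^ (q - 1))
      ≤ t k - (t k ^ 2 - t (k - 1) ^ 2) := by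
    intro k hk
    have hstep := rpow_sq_sub_rpow_sq_le (a := a) (τ := a * k + 1) hq1 (by positivity)
      (by linarith [hτ k hk])
    have hpred : a * (k : ℝ) + 1 - a = a * ((k - 1 : ℕ) : ℝ) + 1 := by
      rw [Nat.cast_sub hk]; push_cast; ring
    rw [hpred, ← ht, ← ht] at hstep
    have hle : (a * (k : ℝ) + 1) ^ (q - 1) ≤ (1 + a) ^ (q - 1) :=
      Real.rpow_le_rpow_of_nonpos (by linarith) (hτ k hk) (by linarith)
    have : 2 * q * a * (a * (k : ℝ) + 1) ^ (q - 1) * t k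
        ≤ 2 * q * a * (1 + a) ^ (q - 1) * t k := by
      have := (htpos k).le
      gcongr
    linarith
  have hδ0 : 0 ≤ 1 - 2 * q * a * (1 + a) ^ (q - 1) := by
    have := mul_le_mul hqa (hdec (1 + a) (by linarith))
      (Real.rpow_nonneg (by linarith) _) zero_le_one
    linarith
  have heq : ∀ k, 1 - t k * (t k - 1) / t (k - 1) ^ 2
      = (t k - (t k ^ 2 - t (k - 1) ^ 2)) / t (k - 1) ^ 2 := fun k => by
    have := (htpos (k - 1)).ne'
    field_simp
    ring
  have hθ : ∀ k, 1 ≤ k → 0 ≤ 1 - t k * (t k - 1) / t (k - 1) ^ 2 := fun k hk => by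
    rw [heq]
    have := (mul_nonneg (htpos k).le hδ0).trans (hdefect k hk)
    positivity
  refine ⟨fun k hk => by linarith [hθ k hk], ?_⟩
  by_cases hcase : q = 1 ∧ a = 1 / 2
  · obtain ⟨rfl, rfl⟩ := hcase
    refine ⟨0, fun k => 2 * c * (1 / (k : ℝ) ^ (p - 1)), fun k => by positivity,
      (Real.summable_one_div_nat_rpow.2 (by linarith [hspec rfl rfl])).mul_left _, ?_⟩
    intro k hk
    have hk1 : (1 : ℝ) ≤ k := by exact_mod_cast hk
    have hk0 : (0 : ℝ) < k := by linarith
    beta_reduce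
    rw [ht, Real.rpow_one, Real.rpow_sub_one hk0.ne', mul_zero, zero_add]
    calc (1 / 2 * (k : ℝ) + 1) * (c / (k : ℝ) ^ p) ≤ 2 * k * (c / (k : ℝ) ^ p) := by
          gcongr; linarith
      _ = 2 * c * (1 / ((k : ℝ) ^ p / k)) := by field_simp
  · have hδ : 0 < 1 - 2 * q * a * (1 + a) ^ (q - 1) := by
      rcases hq2.lt_or_eq with hlt | rfl
      · have h1 : (1 + a) ^ (q - 1) < 1 :=
          Real.rpow_lt_one_of_one_lt_of_neg (by linarith) (by linarith)
        have : 2 * q * a * (1 + a) ^ (q - 1) ≤ 1 * (1 + a) ^ (q - 1) := by gcongr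
        linarith
      · have : a ≠ 1 / 2 := fun h => hcase ⟨rfl, h⟩
        have : a < 1 / 2 := lt_of_le_of_ne (by linarith) this
        norm_num
        linarith
    set δ := 1 - 2 * q * a * (1 + a) ^ (q - 1)
    refine ⟨c * (1 + a) ^ (2 * q) / δ, fun _ => 0, fun _ => le_rfl, summable_zero, ?_⟩
    intro k hk
    have hk1 : (1 : ℝ) ≤ k := by exact_mod_cast hk
    have hk0 : (0 : ℝ) < k := by linarith
    have htk := htpos k
    have hlow : δ / t k ≤ 1 - t k * (t k - 1) / t (k - 1) ^ 2 := by
      rw [heq, div_le_div_iff₀ htk (pow_pos (htpos _) 2)]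
      calc δ * t (k - 1) ^ 2 ≤ δ * t k ^ 2 := by
            have := hmono k hk
            have := (htpos (k - 1)).le
            gcongr
        _ = t k * δ * t k := by ring
        _ ≤ _ := mul_le_mul_of_nonneg_right (hdefect k hk) htk.le
    have hsq : t k ^ 2 ≤ (1 + a) ^ (2 * q) * (k : ℝ) ^ p := by
      calc t k ^ 2 = (a * k + 1) ^ (2 * q) := by
            rw [ht, ← Real.rpow_natCast, ← Real.rpow_mul (by positivity), mul_comm q]; norm_num
        _ ≤ ((1 + a) * k) ^ (2 * q) := by
            refine Real.rpow_le_rpow (by positivity) (by linarith) (by linarith)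
        _ = (1 + a) ^ (2 * q) * (k : ℝ) ^ (2 * q) := Real.mul_rpow (by linarith) hk0.le
        _ ≤ _ := by gcongr
    have hkp : 0 < (k : ℝ) ^ p := Real.rpow_pos_of_pos hk0 p
    calc t k * (c / (k : ℝ) ^ p) = c * t k ^ 2 / (t k * (k : ℝ) ^ p) := by field_simp
      _ ≤ c * ((1 + a) ^ (2 * q) * (k : ℝ) ^ p) / (t k * (k : ℝ) ^ p) := by gcongr
      _ = δ / t k * (c * (1 + a) ^ (2 * q) / δ) := by field_simp
      _ ≤ (1 - t k * (t k - 1) / t (k - 1) ^ 2) * (c * (1 + a) ^ (2 * q) / δ) + 0 := by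
          rw [add_zero]; gcongr

theorem tireprog_p_optimal_rate
    {H : Type*} [NormedAddCommGroup H] [InnerProductSpace ℝ H] [CompleteSpace H]
    (f : H → EReal) (g : H → ℝ) (g' : H → H) (L : ℝ) (hL : 0 < L)
    -- f is proper, convex and lower semicontinuous
    (hf_proper : ∃ z, f z ≠ ⊤) (hf_nebot : ∀ z, f z ≠ ⊥)
    (hf_convex : ∀ u v : H, ∀ a b : ℝ, 0 ≤ a → 0 ≤ b → a + b = 1 →
      f (a • u + b • v) ≤ (a : EReal) * f u + (b : EReal) * f v)
    (hf_lsc : LowerSemicontinuous f)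
    -- g is convex, differentiable with L-Lipschitz gradient g'
    (hg_convex : ConvexOn ℝ Set.univ g)
    (hg_diff : ∀ u : H, HasGradientAt g (g' u) u)
    (hg_lip : ∀ u v : H, ‖g' u - g' v‖ ≤ L * ‖u - v‖)
    -- prox_{σ f} is a minimizer of u ↦ f(u) + ‖u − z‖²/(2σ)
    (prox : ℝ → H → H)
    (hprox : ∀ σ : ℝ, 0 < σ → ∀ z u : H,
      f (prox σ z) + ((‖prox σ z - z‖ ^ 2 / (2 * σ) : ℝ) : EReal)
        ≤ f u + ((‖u - z‖ ^ 2 / (2 * σ) : ℝ) : EReal))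
    -- the parameters q, a, c, p with t_k = (ak+1)^q and ε_k = c/k^p
    (q a c p : ℝ) (hq1 : 1 / 2 ≤ q) (hq2 : q ≤ 1)
    (ha1 : 0 < a) (ha2 : a ≤ 1 / (2 * q)) (hc : 0 < c) (hp : 2 * q ≤ p)
    (hspec : q = 1 → a = 1 / 2 → 2 < p)
    (t : ℕ → ℝ) (ht : ∀ k : ℕ, t k = (a * k + 1) ^ q)
    (ε : ℕ → ℝ) (hε : ∀ k : ℕ, 1 ≤ k → ε k = c / (k : ℝ) ^ p)
    -- the stepsize
    (s : ℝ) (hs_pos : 0 < s) (hs_lt : s < 1 / L)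
    -- the algorithm (TIREPROG)
    (x y : ℕ → H)
    (hy : ∀ k : ℕ, 1 ≤ k → y k = x k
        + (((t k - 1) * (t (k - 1) - 1)) / (t (k - 1)) ^ 2) • (x k - x (k - 1))
        - (((-(t k) ^ 2 + t k + (t (k - 1)) ^ 2) / ((t (k - 1)) ^ 2 * t k))) • x k)
    (hx : ∀ k : ℕ, 1 ≤ k →
      x (k + 1) = prox s (y k - s • g' (y k) - (s * ε k) • y k))
    -- a (global) minimizer of f + g, so that (f+g)(xmin) = min (f+g)
    (xmin : H)
    (hxmin : ∀ u : H, f xmin + (g xmin : EReal) ≤ f u + (g u : EReal))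
 :
    ∃ C : ℝ, 0 < C ∧ ∃ K : ℕ, ∀ k : ℕ, K ≤ k →
      f (x k) + (g (x k) : EReal)
        ≤ f xmin + (g xmin : EReal) + ((C / (k : ℝ) ^ (2 * q) : ℝ) : EReal) := by
  have hL1 : s * L < 1 := by rwa [lt_div_iff₀ hL] at hs_lt
  have hxmin_top : f xmin ≠ ⊤ := by
    obtain ⟨z, hz⟩ := hf_proper
    intro htop
    have h := hxmin z
    rw [htop, EReal.top_add_coe, top_le_iff] at h
    exact EReal.add_ne_top hz (EReal.coe_ne_top _) h
  have hprox_top : ∀ z, f (prox s z) ≠ ⊤ := by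
    intro z htop
    have h := hprox s hs_pos z xmin
    rw [htop, EReal.top_add_coe, top_le_iff] at h
    exact EReal.add_ne_top hxmin_top (EReal.coe_ne_top _) h
  have hx_top : ∀ k, 2 ≤ k → f (x k) ≠ ⊤ := by
    intro k hk
    obtain ⟨j, rfl⟩ : ∃ j, k = j + 1 := ⟨k - 1, by omega⟩
    rw [hx j (by omega)]
    exact hprox_top _
  set Fstar := (f xmin).toReal + g xmin with hFstar
  have hF_nonneg : ∀ k, 2 ≤ k → 0 ≤ (f (x k)).toReal + g (x k) - Fstar := by
    intro k hk
    have h := hxmin (x k)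
    rw [← EReal.coe_toReal hxmin_top (hf_nebot _),
      ← EReal.coe_toReal (hx_top k hk) (hf_nebot _)] at h
    norm_cast at h
    linarith
  have ht1 : ∀ k, 1 ≤ t k := fun k => by
    rw [ht]
    refine Real.one_le_rpow ?_ (by linarith)
    have : 0 ≤ a * (k : ℝ) := by positivity
    linarith
  have hp0 : 0 < p := by linarith
  have hε0 : ∀ k, 1 ≤ k → 0 ≤ ε k := fun k hk => by rw [hε k hk]; positivity
  have hεlim : Tendsto (fun k : ℕ => s * (L + c / (k : ℝ) ^ p)) atTop (𝓝 (s * (L + 0))) := by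
    refine (tendsto_const_nhds.add ?_).const_mul s
    exact ((tendsto_rpow_atTop hp0).comp tendsto_natCast_atTop_atTop).const_div_atTop c
  obtain ⟨K₀, hK₀⟩ := eventually_atTop.1
    (hεlim.eventually_le_const (by rwa [add_zero] : s * (L + 0) < 1))
  obtain ⟨hθ1, M, b, hb0, hbsum, hbM⟩ :=
    exists_absorbing_bound hq1 hq2 ha1 ha2 hc hp hspec ht
  set E : ℕ → ℝ := fun k =>
    t (k - 1) ^ 2 * ((f (x k)).toReal + g (x k) + ε (k - 1) / 2 * ‖x k‖ ^ 2 - Fstar)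
      + ‖t (k - 1) • x k - (t (k - 1) - 1) • x (k - 1) - xmin‖ ^ 2 / (2 * s) with hE
  have hrec : ∀ k, max K₀ 2 ≤ k → E (k + 1)
      ≤ t k * (t k - 1) / t (k - 1) ^ 2 * E k
        + (1 - t k * (t k - 1) / t (k - 1) ^ 2) * (‖xmin‖ ^ 2 / (2 * s) + ‖xmin‖ ^ 2 / 2 * M)
        + ‖xmin‖ ^ 2 / 2 * b k := by
    intro k hk
    have hk2 : 2 ≤ k := le_trans (le_max_right _ _) hk
    have hk1 : 1 ≤ k := by omega
    have hsL : s * (L + ε k) ≤ 1 := by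
      rw [hε k hk1]; exact hK₀ k (le_trans (le_max_left _ _) hk)
    have hw : ∀ u, f (x (k + 1))
          + ((‖x (k + 1) - (y k - s • g' (y k) - (s * ε k) • y k)‖ ^ 2 / (2 * s) : ℝ) : EReal)
        ≤ f u + ((‖u - (y k - s • g' (y k) - (s * ε k) • y k)‖ ^ 2 / (2 * s) : ℝ) : EReal) := by
      intro u
      rw [hx k hk1]
      exact hprox s hs_pos _ u
    have hstep := fun z (hz : f z ≠ ⊤) => toReal_regularized_prox_grad_step_le hf_nebot hf_convex
      hg_convex hg_diff hg_lip hs_pos (hε0 k hk1) hsL hw (hx_top (k + 1) (by omega)) hz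
    have hr0 : t (k - 1) ≠ 0 := by linarith [ht1 (k - 1)]
    have htk0 : t k ≠ 0 := by linarith [ht1 k]
    have hεmono : ε k ≤ ε (k - 1) := by
      rw [hε k hk1, hε (k - 1) (by omega)]
      have h1 : (0 : ℝ) < ((k - 1 : ℕ) : ℝ) := by exact_mod_cast (by omega : 0 < k - 1)
      have h2 : ((k - 1 : ℕ) : ℝ) ≤ k := by exact_mod_cast Nat.sub_le k 1
      gcongr
    have hu : t k • y k - (t k - 1) • x k = (t k * (t k - 1) / t (k - 1) ^ 2) •
        (t (k - 1) • x k - (t (k - 1) - 1) • x (k - 1)) := by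
      rw [hy k hk1]
      match_scalars <;> field_simp <;> ring
    have hen := inertial_energy_step (θ := t k * (t k - 1) / t (k - 1) ^ 2) (r := t (k - 1))
      hs_pos (ht1 k) (by field_simp)
      (div_nonneg (mul_nonneg (by linarith [ht1 k]) (by linarith [ht1 k])) (sq_nonneg _))
      (hθ1 k hk1) hεmono hu (hstep (x k) (hx_top k hk2)) (hstep xmin hxmin_top)
    have habs := mul_le_mul_of_nonneg_left (hbM k hk1) (by positivity : 0 ≤ ‖xmin‖ ^ 2 / 2)
    rw [← hε k hk1] at habs
    simp only [hE, Nat.add_sub_cancel]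
    linarith
  obtain ⟨B, hB⟩ := bddAbove_of_contraction_add_summable
    (fun k _ => div_nonneg (mul_nonneg (by linarith [ht1 k]) (by linarith [ht1 k])) (sq_nonneg _))
    (fun k hk => hθ1 k (by have := le_trans (le_max_right _ _) hk; omega))
    (fun k => mul_nonneg (by positivity) (hb0 k)) (hbsum.mul_left (‖xmin‖ ^ 2 / 2)) hrec
  have ha_one : a ≤ 1 := ha2.trans (by rw [div_le_one (by linarith)]; linarith)
  refine ⟨(|B| + 1) / a ^ (2 * q), by positivity, max K₀ 2, fun k hk => ?_⟩
  have hk2 : 2 ≤ k := le_trans (le_max_right _ _) hk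
  have hk0 : (0 : ℝ) < k := by exact_mod_cast (by omega : 0 < k)
  have hlow : a ^ (2 * q) * (k : ℝ) ^ (2 * q) ≤ t (k - 1) ^ 2 := by
    have h1 : (0 : ℝ) ≤ a * ((k - 1 : ℕ) : ℝ) + 1 := by positivity
    rw [ht, ← Real.rpow_natCast, ← Real.rpow_mul h1, ← Real.mul_rpow ha1.le hk0.le,
      mul_comm q]
    push_cast
    refine Real.rpow_le_rpow (by positivity) ?_ (by linarith)
    rw [Nat.cast_sub (by omega : 1 ≤ k)]
    push_cast
    linarith
  have hEk : t (k - 1) ^ 2 * ((f (x k)).toReal + g (x k) - Fstar) ≤ B := by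
    refine le_trans ?_ (hB k hk)
    have h1 : 0 ≤ ε (k - 1) / 2 * ‖x k‖ ^ 2 :=
      mul_nonneg (by linarith [hε0 (k - 1) (by omega)]) (sq_nonneg _)
    have h2 : 0 ≤ ‖t (k - 1) • x k - (t (k - 1) - 1) • x (k - 1) - xmin‖ ^ 2 / (2 * s) := by
      positivity
    have h3 := mul_nonneg (sq_nonneg (t (k - 1))) h1
    simp only [hE]
    linarith
  have hfinal : (f (x k)).toReal + g (x k) - Fstar
      ≤ (|B| + 1) / a ^ (2 * q) / (k : ℝ) ^ (2 * q) := by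
    rw [div_div, le_div_iff₀ (by positivity), mul_comm]
    linarith [mul_le_mul_of_nonneg_right hlow (hF_nonneg k hk2), le_abs_self B]
  rw [← EReal.coe_toReal hxmin_top (hf_nebot _),
    ← EReal.coe_toReal (hx_top k hk2) (hf_nebot _)]
  norm_cast
  linarith
end

section
/- Let 1/2 ≤ q ≤ 1 and 0 < a ≤ 1/(2q), and set t_k = (ak+1)^q for k ≥ 0. Then (t_k) satisfies condition (T): t_0 = 1 and, for all k ≥ 1, t_{k−1} < t_k < (1 + √(1 + 4 t_{k−1}²))/2; equivalently, for all integers k ≥ 1 one has (ak+1−a)^{2q} + (ak+1)^q − (ak+1)^{2q} > 0. -/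
open Filter Topology

/-- A step of size `a ≤ 1 / (2q)` increases the `2q`-th power by less than `x ^ q`. -/
lemma rpow_two_mul_lt_sub_rpow_add {q a x : ℝ} (hq1 : 1 / 2 ≤ q) (hq2 : q ≤ 1)
    (ha1 : 0 < a) (ha2 : a ≤ 1 / (2 * q)) (hx : 1 < x) (hax : a ≤ x) :
    x ^ (2 * q) < (x - a) ^ (2 * q) + x ^ q := by
  have hq : 0 < 2 * q := by linarith
  have hx0 : 0 < x := by linarith
  have haq : 2 * q * a ≤ 1 := by
    rw [le_div_iff₀ hq] at ha2
    linarith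
  rcases hq2.eq_or_lt with rfl | hlt
  · norm_num
    nlinarith [mul_nonneg hx0.le (sub_nonneg.2 haq)]
  · have hbern : 1 + 2 * q * (-(a / x)) ≤ (1 + -(a / x)) ^ (2 * q) :=
      one_add_mul_self_le_rpow_one_add (by linarith [(div_le_one hx0).2 hax]) (by linarith)
    have hfac : (x - a) ^ (2 * q) = x ^ (2 * q) * (1 + -(a / x)) ^ (2 * q) := by
      rw [← Real.mul_rpow hx0.le (by linarith [(div_le_one hx0).2 hax])]
      congr 1
      field_simp
      ring
    have hpow : x ^ (2 * q) = x ^ (2 * q - 1) * x := by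
      rw [← Real.rpow_add_one hx0.ne']
      congr 1
      ring
    have hlow : x ^ (2 * q) - x ^ (2 * q - 1) * (2 * q * a) ≤ (x - a) ^ (2 * q) := by
      rw [hfac]
      refine le_trans (le_of_eq ?_)
        (mul_le_mul_of_nonneg_left hbern (Real.rpow_nonneg hx0.le _))
      rw [hpow]
      field_simp
      ring
    have hexp : x ^ (2 * q - 1) < x ^ q := Real.rpow_lt_rpow_of_exponent_lt hx (by linarith)
    have hmul : x ^ (2 * q - 1) * (2 * q * a) ≤ x ^ (2 * q - 1) :=
      mul_le_of_le_one_right (Real.rpow_nonneg hx0.le _) haq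
    linarith

/-- For `1/2 ≤ q ≤ 1` and `0 < a ≤ 1/(2q)`, the sequence `t_k = (ak+1)^q` satisfies
condition (T), equivalently `(ak+1−a)^{2q} + (ak+1)^q − (ak+1)^{2q} > 0` for `k ≥ 1`. -/
theorem tk_satisfies_condition_T (q a : ℝ) (hq1 : 1 / 2 ≤ q) (hq2 : q ≤ 1)
    (ha1 : 0 < a) (ha2 : a ≤ 1 / (2 * q))
    (t : ℕ → ℝ) (ht : ∀ k : ℕ, t k = (a * k + 1) ^ q) :
    t 0 = 1 ∧
    (∀ k : ℕ, 1 ≤ k →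
      t (k - 1) < t k ∧ t k < (1 + Real.sqrt (1 + 4 * t (k - 1) ^ 2)) / 2) ∧
    (∀ k : ℕ, 1 ≤ k →
      0 < (a * k + 1 - a) ^ (2 * q) + (a * k + 1) ^ q - (a * k + 1) ^ (2 * q)) := by
  have hmain : ∀ k : ℕ, 1 ≤ k →
      0 < (a * k + 1 - a) ^ (2 * q) + (a * k + 1) ^ q - (a * k + 1) ^ (2 * q) := by
    intro k hk
    have hak : a ≤ a * k := le_mul_of_one_le_right ha1.le (by exact_mod_cast hk)
    linarith [rpow_two_mul_lt_sub_rpow_add hq1 hq2 ha1 ha2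
      (by linarith : 1 < a * k + 1) (by linarith)]
  refine ⟨by simp [ht], fun k hk => ?_, hmain⟩
  have hak : a ≤ a * k := le_mul_of_one_le_right ha1.le (by exact_mod_cast hk)
  have hprev : t (k - 1) = (a * k + 1 - a) ^ q := by
    rw [ht, Nat.cast_sub hk]
    congr 1
    push_cast
    ring
  have hsq : ∀ y : ℝ, 0 ≤ y → y ^ (2 * q) = (y ^ q) ^ 2 := fun y hy => by
    rw [mul_comm, Real.rpow_mul hy, Real.rpow_two]
  have hk' := hmain k hk
  rw [hsq _ (by linarith), hsq _ (by linarith), ← hprev, ← ht] at hk'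
  constructor
  · rw [hprev, ht]
    exact Real.rpow_lt_rpow (by linarith) (by linarith) (by linarith)
  · have hroot : 2 * t k - 1 < Real.sqrt (1 + 4 * t (k - 1) ^ 2) :=
      Real.lt_sqrt_of_sq_lt (by linarith)
    linarith
end

section
/- Let (t_k)_{k≥0} be a sequence of reals satisfying condition (T) and assume t_k → +∞ as k → +∞. Then t_k/t_{k−1} → 1 as k → +∞. -/
open Filter Topology

/-- If `(t_k)` satisfies condition (T) and `t_k → +∞`, then `t_k / t_{k−1} → 1`. -/
theorem condition_T_ratio_tendsto_one (t : ℕ → ℝ) (ht0 : t 0 = 1)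
    (hT : ∀ k : ℕ, 1 ≤ k →
      t (k - 1) < t k ∧ t k < (1 + Real.sqrt (1 + 4 * t (k - 1) ^ 2)) / 2)
    (htop : Tendsto t atTop atTop) :
    Tendsto (fun k : ℕ => t k / t (k - 1)) atTop (nhds (1 : ℝ)) := by
  have hprev : Tendsto (fun k : ℕ => t (k - 1)) atTop atTop :=
    htop.comp (tendsto_sub_atTop_nat 1)
  have hupper : Tendsto (fun k : ℕ => 1 + (t (k - 1))⁻¹) atTop (nhds 1) := by
    simpa using (tendsto_inv_atTop_zero.comp hprev).const_add 1
  refine tendsto_of_tendsto_of_tendsto_of_le_of_le' tendsto_const_nhds hupper ?_ ?_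
  · filter_upwards [eventually_ge_atTop 1, hprev.eventually_gt_atTop 0] with k hk hpos
    exact (one_le_div hpos).2 (hT k hk).1.le
  · filter_upwards [eventually_ge_atTop 1, hprev.eventually_gt_atTop 0] with k hk hpos
    have hsqrt : Real.sqrt (1 + 4 * t (k - 1) ^ 2) ≤ 1 + 2 * t (k - 1) :=
      Real.sqrt_le_iff.2 ⟨by positivity, by nlinarith⟩
    have hmul : (1 + (t (k - 1))⁻¹) * t (k - 1) = t (k - 1) + 1 := by
      field_simp
    rw [div_le_iff₀ hpos, hmul]
    linarith [(hT k hk).2]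
end
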